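/- arXiv:1509.05364 — 3 statements merged into one kernel-verified Lean document; each statement's English description precedes it below -/
import Mathlib

section
/- Let M be a finite monoid and m ∈ ℕ. Then: (i) if the equation U_1 = V_1 holds in M, then M is J-trivial (i.e. M ∈ R_1 = L_1 = J); (ii) if the equation (U_m x_{m+1})^π U_m = (U_m x_{m+1})^π V_m holds in M, then M ∈ R_{m+1}; (iii) if the equation U_m (y_{m+1} U_m)^π = V_m (y_{m+1} U_m)^π holds in M, then M ∈ L_{m+1}; (iv) if the equation U_m = V_m holds in M, then M ∈ R_{m+1} ∩ L_{m+1}. -/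
open scoped Classical

/-! ## Generalized words -/

structure GWord (A : Type) : Type 1 where
  P : Type
  ord : LinearOrder P
  w : P → A

namespace GWord

variable {A : Type}

instance (u : GWord A) : LinearOrder u.P := u.ord

/-- The set of letters occurring in a generalized word. -/
def alph (u : GWord A) : Set A := Set.range u.w

/-- Restriction of a generalized word to a set of positions. -/
def restrict (u : GWord A) (s : Set u.P) : GWord A :=
  ⟨{ p // p ∈ s }, inferInstance, fun p => u.w p.1⟩

/-- `p` is the first `a`-labelled position of `u`. -/
def IsFirst (u : GWord A) (a : A) (p : u.P) : Prop :=
  u.w p = a ∧ ∀ q : u.P, u.w q = a → p ≤ q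

/-- `p` is the last `a`-labelled position of `u`. -/
def IsLast (u : GWord A) (a : A) (p : u.P) : Prop :=
  u.w p = a ∧ ∀ q : u.P, u.w q = a → q ≤ p

/-- The factor strictly before the first occurrence of `a`. -/
noncomputable def XL (u : GWord A) (a : A) : GWord A :=
  if h : ∃ p, u.IsFirst a p then u.restrict {q | q < h.choose} else u

/-- The factor strictly after the first occurrence of `a`. -/
noncomputable def XR (u : GWord A) (a : A) : GWord A :=
  if h : ∃ p, u.IsFirst a p then u.restrict {q | h.choose < q} else u

/-- The factor strictly before the last occurrence of `a`. -/
noncomputable def YL (u : GWord A) (a : A) : GWord A :=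
  if h : ∃ p, u.IsLast a p then u.restrict {q | q < h.choose} else u

/-- The factor strictly after the last occurrence of `a`. -/
noncomputable def YR (u : GWord A) (a : A) : GWord A :=
  if h : ∃ p, u.IsLast a p then u.restrict {q | h.choose < q} else u

/-- `C_{a,b}` is defined iff the first `a` is strictly to the right of the last `b`. -/
def CDefined (u : GWord A) (a b : A) : Prop :=
  ∃ p q, u.IsFirst a p ∧ u.IsLast b q ∧ q < p

/-- The factor strictly between the last `b` and the first `a` (junk value if undefined). -/
noncomputable def Cab (u : GWord A) (a b : A) : GWord A :=
  if h : u.CDefined a b then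
    u.restrict {r | h.choose_spec.choose < r ∧ r < h.choose}
  else u

/-- Accessibility: first/last occurrences of letters after/before every position exist. -/
def Accessible (u : GWord A) : Prop :=
  (∀ a : A, (∃ p, u.w p = a) → ∃ p, u.IsFirst a p) ∧
  (∀ a : A, (∃ p, u.w p = a) → ∃ p, u.IsLast a p) ∧
  (∀ (p : u.P) (a : A), (∃ q, p < q ∧ u.w q = a) →
    ∃ q, p < q ∧ u.w q = a ∧ ∀ r, p < r → u.w r = a → q ≤ r) ∧
  (∀ (p : u.P) (a : A), (∃ q, q < p ∧ u.w q = a) →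
    ∃ q, q < p ∧ u.w q = a ∧ ∀ r, r < p → u.w r = a → r ≤ q)

/-- Concatenation of generalized words. -/
def append (u v : GWord A) : GWord A :=
  ⟨u.P ⊕ₗ v.P, inferInstance, fun x => Sum.elim u.w v.w (ofLex x)⟩

/-- The power of a generalized word by an arbitrary linear order type `ν`
(positions ordered with the exponent component dominant). -/
def gpow (u : GWord A) (ν : Type) [LinearOrder ν] : GWord A :=
  ⟨ν ×ₗ u.P, inferInstance, fun x => u.w (ofLex x).2⟩

/-- A finite word as a generalized word. -/
def ofList (l : List A) : GWord A :=
  ⟨Fin l.length, inferInstance, fun i => l.get i⟩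

end GWord

/-- The order type `ω + ω*`: a copy of `ℕ` followed by a reversed copy of `ℕ`. -/
abbrev OO : Type := ℕ ⊕ₗ ℕᵒᵈ

/-! ## The relations `≡_{m,n}^Z` -/

inductive ZK : Type
  | X | Y | WI

inductive ZKind : Type
  | X | Y | XY | WI

/-- The relations `≡_{m,n}^X`, `≡_{m,n}^Y`, `≡_{m,n}^{WI}` (first argument is `n`). -/
def eqvAux {A : Type} : ℕ → ZK → ℕ → GWord A → GWord A → Prop
  | 0, _, _, _, _ => True
  | _ + 1, _, 0, _, _ => True
  | n + 1, ZK.X, m + 1, u, v =>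
      u.alph = v.alph ∧ eqvAux n ZK.Y m u v ∧
      ∀ a ∈ u.alph, eqvAux n ZK.Y m (u.XL a) (v.XL a) ∧
        eqvAux n ZK.X (m + 1) (u.XR a) (v.XR a)
  | n + 1, ZK.Y, m + 1, u, v =>
      u.alph = v.alph ∧ eqvAux n ZK.X m u v ∧
      ∀ a ∈ u.alph, eqvAux n ZK.Y (m + 1) (u.YL a) (v.YL a) ∧
        eqvAux n ZK.X m (u.YR a) (v.YR a)
  | n + 1, ZK.WI, m + 1, u, v =>
      u.alph = v.alph ∧
      (∀ a ∈ u.alph,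
        eqvAux n ZK.WI m (u.XL a) (v.XL a) ∧ eqvAux n ZK.WI (m + 1) (u.XR a) (v.XR a) ∧
        eqvAux n ZK.WI (m + 1) (u.YL a) (v.YL a) ∧ eqvAux n ZK.WI m (u.YR a) (v.YR a)) ∧
      ∀ a ∈ u.alph, ∀ b ∈ u.alph,
        (u.CDefined a b ↔ v.CDefined a b) ∧
        (u.CDefined a b → v.CDefined a b → eqvAux n ZK.WI m (u.Cab a b) (v.Cab a b))

/-- `wEquiv Z m n u v` is `u ≡_{m,n}^Z v`. -/
def wEquiv {A : Type} (Z : ZKind) (m n : ℕ) (u v : GWord A) : Prop :=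
  match Z with
  | ZKind.X => eqvAux n ZK.X m u v
  | ZKind.Y => eqvAux n ZK.Y m u v
  | ZKind.XY => eqvAux n ZK.X m u v ∧ eqvAux n ZK.Y m u v
  | ZKind.WI => eqvAux n ZK.WI m u v

/-! ## π-terms -/

inductive PiTerm (A : Type) : Type
  | eps : PiTerm A
  | letter : A → PiTerm A
  | mul : PiTerm A → PiTerm A → PiTerm A
  | pi : PiTerm A → PiTerm A

def listNPow {A : Type} (l : List A) : ℕ → List A
  | 0 => []
  | k + 1 => l ++ listNPow l k

/-- `[γ]_k`: substitute the natural number `k` for the formal power `π`. -/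
def PiTerm.substNat {A : Type} : PiTerm A → ℕ → List A
  | .eps, _ => []
  | .letter a, _ => [a]
  | .mul α β, k => α.substNat k ++ β.substNat k
  | .pi γ, k => listNPow (γ.substNat k) k

/-- `[γ]_{ω+ω*}`: substitute the order type `ω + ω*` for the formal power `π`. -/
def PiTerm.substOO {A : Type} : PiTerm A → GWord A
  | .eps => GWord.ofList []
  | .letter a => GWord.ofList [a]
  | .mul α β => α.substOO.append β.substOO
  | .pi γ => γ.substOO.gpow OO

/-! ## Finite monoids, equations, the Trotter–Weil hierarchy -/

/-- `M!`: the exponent of a finite monoid, the least `n ≥ 1` such that all `x^n` are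
idempotent. -/
noncomputable def monoidExp (M : Type) [Monoid M] : ℕ :=
  sInf {n : ℕ | 1 ≤ n ∧ ∀ x : M, IsIdempotentElem (x ^ n)}

/-- The equation `α = β` of π-terms holds in the finite monoid `M`. -/
def EqHoldsIn {A : Type} (α β : PiTerm A) (M : Type) [Monoid M] : Prop :=
  ∀ σ : FreeMonoid A →* M,
    σ (FreeMonoid.ofList (α.substNat (monoidExp M))) =
      σ (FreeMonoid.ofList (β.substNat (monoidExp M)))

/-- Green's relation `R`: `x R y` iff `xM = yM`. -/
def rGreen {M : Type} [Monoid M] (x y : M) : Prop :=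
  Set.range (fun z => x * z) = Set.range (fun z => y * z)

/-- Green's relation `L`: `x L y` iff `Mx = My`. -/
def lGreen {M : Type} [Monoid M] (x y : M) : Prop :=
  Set.range (fun z => z * x) = Set.range (fun z => z * y)

/-- `J`-triviality: `MxM = MyM` implies `x = y`. -/
def IsJTrivial (M : Type) [Monoid M] : Prop :=
  ∀ x y : M, {z | ∃ a b, z = a * x * b} = {z | ∃ a b, z = a * y * b} → x = y

/-- The relation `∼_K`. -/
def simK {M : Type} [Monoid M] (x y : M) : Prop :=
  ∀ e : M, IsIdempotentElem e → (rGreen (e * x) e ∨ rGreen (e * y) e) → e * x = e * y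

/-- The relation `∼_D`. -/
def simD {M : Type} [Monoid M] (x y : M) : Prop :=
  ∀ e : M, IsIdempotentElem e → (lGreen (x * e) e ∨ lGreen (y * e) e) → x * e = y * e

/-- `∼_K` as a congruence (it is a congruence, so `conGen` does not change it). -/
def KCon (M : Type) [Monoid M] : Con M := conGen simK

/-- `∼_D` as a congruence. -/
def DCon (M : Type) [Monoid M] : Con M := conGen simD

/-- `InRLAux k true M _ = (M ∈ R_{k+1})` and `InRLAux k false M _ = (M ∈ L_{k+1})`. -/
def InRLAux : ℕ → Bool → (M : Type) → Monoid M → Prop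
  | 0, _, M, i => letI := i; IsJTrivial M
  | k + 1, true, M, i => letI := i; InRLAux k false (KCon M).Quotient inferInstance
  | k + 1, false, M, i => letI := i; InRLAux k true (DCon M).Quotient inferInstance

/-- `M ∈ R_m` (for `m ≥ 1`). -/
def InRm (m : ℕ) (M : Type) [i : Monoid M] : Prop := InRLAux (m - 1) true M i

/-- `M ∈ L_m` (for `m ≥ 1`). -/
def InLm (m : ℕ) (M : Type) [i : Monoid M] : Prop := InRLAux (m - 1) false M i

/-- `N` divides `M`: `N` is a homomorphic image of a submonoid of `M`. -/
def MDivides (N M : Type) [Monoid N] [Monoid M] : Prop :=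
  ∃ (S : Submonoid M) (f : S →* N), Function.Surjective f

/-- `N ∈ R_m ∨ L_m`: `N` divides a direct product `M₁ × M₂` with `M₁ ∈ R_m`, `M₂ ∈ L_m`. -/
def InJoin (m : ℕ) (N : Type) [Monoid N] : Prop :=
  ∃ (M₁ M₂ : Type) (i₁ : Monoid M₁) (i₂ : Monoid M₂),
    letI := i₁; letI := i₂;
    Finite M₁ ∧ Finite M₂ ∧ InRm m M₁ ∧ InLm m M₂ ∧ MDivides N (M₁ × M₂)

/-- `M ∈ DA`, via the equation `(xyz)^{M!} y (xyz)^{M!} = (xyz)^{M!}`. -/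
def InDA (M : Type) [Monoid M] : Prop :=
  ∀ x y z : M,
    (x * y * z) ^ monoidExp M * y * (x * y * z) ^ monoidExp M = (x * y * z) ^ monoidExp M

/-! ## The π-terms `U_m`, `V_m` -/

inductive UVLetter : Type
  | s | t | x (i : ℕ) | y (i : ℕ)

/-- `U_m` (indexed from 1; `Uterm 0` is a junk value). -/
def Uterm : ℕ → PiTerm UVLetter
  | 0 => PiTerm.eps
  | 1 =>
      PiTerm.mul
        (PiTerm.pi (PiTerm.mul (PiTerm.letter UVLetter.s) (PiTerm.letter (UVLetter.x 1))))
        (PiTerm.mul (PiTerm.letter UVLetter.s)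
          (PiTerm.pi (PiTerm.mul (PiTerm.letter (UVLetter.y 1)) (PiTerm.letter UVLetter.t))))
  | m + 2 =>
      PiTerm.mul
        (PiTerm.pi (PiTerm.mul (Uterm (m + 1)) (PiTerm.letter (UVLetter.x (m + 2)))))
        (PiTerm.mul (Uterm (m + 1))
          (PiTerm.pi (PiTerm.mul (PiTerm.letter (UVLetter.y (m + 2))) (Uterm (m + 1)))))

/-- `V_m` (indexed from 1; `Vterm 0` is a junk value). -/
def Vterm : ℕ → PiTerm UVLetter
  | 0 => PiTerm.eps
  | 1 =>
      PiTerm.mul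
        (PiTerm.pi (PiTerm.mul (PiTerm.letter UVLetter.s) (PiTerm.letter (UVLetter.x 1))))
        (PiTerm.mul (PiTerm.letter UVLetter.t)
          (PiTerm.pi (PiTerm.mul (PiTerm.letter (UVLetter.y 1)) (PiTerm.letter UVLetter.t))))
  | m + 2 =>
      PiTerm.mul
        (PiTerm.pi (PiTerm.mul (Uterm (m + 1)) (PiTerm.letter (UVLetter.x (m + 2)))))
        (PiTerm.mul (Vterm (m + 1))
          (PiTerm.pi (PiTerm.mul (PiTerm.letter (UVLetter.y (m + 2))) (Uterm (m + 1)))))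

/-- The relation `≡_{m,n}^Z` on the free monoid `Σ*`, as a congruence
(it is a congruence, so `conGen` does not change it). -/
def eqvCon (A : Type) (Z : ZKind) (m n : ℕ) : Con (FreeMonoid A) :=
  conGen (fun u v => wEquiv Z m n (GWord.ofList u.toList) (GWord.ofList v.toList))

/-! ## Values of π-terms -/

namespace PiTerm

variable {A M N : Type} [Monoid M] [Monoid N]

/-- The value in `M` of a π-term under an assignment of the letters, with `π` read as `n`. -/
def eval (n : ℕ) (f : A → M) : PiTerm A → M
  | .eps => 1
  | .letter a => f a
  | .mul α β => eval n f α * eval n f β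
  | .pi γ => eval n f γ ^ n

theorem map_listNPow (σ : FreeMonoid A →* M) (l : List A) (k : ℕ) :
    σ (FreeMonoid.ofList (listNPow l k)) = σ (FreeMonoid.ofList l) ^ k := by
  induction k with
  | zero => simp [listNPow]
  | succ k ih => rw [listNPow, FreeMonoid.ofList_append, map_mul, ih, pow_succ']

theorem map_substNat (σ : FreeMonoid A →* M) (n : ℕ) (α : PiTerm A) :
    σ (FreeMonoid.ofList (α.substNat n)) = α.eval n fun a => σ (FreeMonoid.of a) := by
  induction α with
  | eps => simp [substNat, eval]
  | letter a => simp [substNat, eval]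
  | mul α β hα hβ => simp [substNat, eval, FreeMonoid.ofList_append, hα, hβ]
  | pi γ hγ => simp [substNat, eval, map_listNPow, hγ]

theorem map_eval (φ : M →* N) (n : ℕ) (f : A → M) (α : PiTerm A) :
    φ (α.eval n f) = α.eval n fun a => φ (f a) := by
  induction α with
  | eps => simp [eval]
  | letter a => simp [eval]
  | mul α β hα hβ => simp [eval, hα, hβ]
  | pi γ hγ => simp [eval, hγ]

end PiTerm

/-- The equation `α = β` holds in `M` when `π` is read as the exponent `n`. -/
def EqHoldsAt {A : Type} (n : ℕ) (α β : PiTerm A) (M : Type) [Monoid M] : Prop :=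
  ∀ f : A → M, α.eval n f = β.eval n f

theorem EqHoldsIn.eqHoldsAt {A M : Type} [Monoid M] {α β : PiTerm A} (h : EqHoldsIn α β M) :
    EqHoldsAt (monoidExp M) α β M := fun f => by
  simpa [PiTerm.map_substNat] using h (FreeMonoid.lift f)

theorem Con.eqHoldsAt_quotient {A M : Type} [Monoid M] {n : ℕ} {α β : PiTerm A} (c : Con M)
    (h : ∀ f : A → M, c (α.eval n f) (β.eval n f)) : EqHoldsAt n α β c.Quotient := by
  intro g
  have hg : g = fun a => c.mk' (Quotient.out (g a)) := by
    funext a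
    exact (Quotient.out_eq (g a)).symm
  rw [hg, ← PiTerm.map_eval, ← PiTerm.map_eval]
  exact c.eq.2 (h _)

/-! ## Exponents -/

/-- `n` is a positive exponent all of whose powers in `M` are idempotent. -/
def IsIdemExp (n : ℕ) (M : Type) [Monoid M] : Prop :=
  1 ≤ n ∧ ∀ x : M, IsIdempotentElem (x ^ n)

theorem exists_isIdemExp (M : Type) [Monoid M] [Finite M] : ∃ n, IsIdemExp n M := by
  have hx : ∀ x : M, ∃ k, 1 ≤ k ∧ IsIdempotentElem (x ^ k) := by
    intro x
    obtain ⟨i, j, hij, hxij⟩ : ∃ i j : ℕ, i < j ∧ x ^ i = x ^ j := by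
      obtain ⟨i, j, hne, h⟩ := Finite.exists_ne_map_eq_of_infinite fun k : ℕ => x ^ k
      rcases lt_or_gt_of_ne hne with hlt | hlt
      · exact ⟨i, j, hlt, h⟩
      · exact ⟨j, i, hlt, h.symm⟩
    obtain ⟨p, rfl⟩ := Nat.exists_eq_add_of_le hij.le
    have hp : 0 < p := by omega
    have hstep : ∀ l, i ≤ l → x ^ (l + p) = x ^ l := by
      intro l hl
      obtain ⟨d, rfl⟩ := Nat.exists_eq_add_of_le hl
      rw [show i + d + p = (i + p) + d by ring, pow_add, ← hxij, ← pow_add]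
    have hmul : ∀ q l, i ≤ l → x ^ (l + q * p) = x ^ l := by
      intro q
      induction q with
      | zero => intro l _; simp
      | succ q ih =>
        intro l hl
        rw [show l + (q + 1) * p = (l + q * p) + p by ring, hstep _ (by omega), ih l hl]
    refine ⟨(i + 1) * p, Nat.mul_pos (by omega) hp, ?_⟩
    rw [IsIdempotentElem, ← pow_add]
    exact hmul _ _ (by nlinarith)
  choose k hk hidem using hx
  have := Fintype.ofFinite M
  refine ⟨∏ x, k x, Nat.one_le_iff_ne_zero.2 (Finset.prod_ne_zero_iff.2 fun x _ => ?_),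
    fun x => ?_⟩
  · have := hk x
    omega
  · rw [← Finset.mul_prod_erase _ k (Finset.mem_univ x), pow_mul]
    exact (hidem x).pow _

theorem isIdemExp_monoidExp (M : Type) [Monoid M] [Finite M] : IsIdemExp (monoidExp M) M :=
  Nat.sInf_mem (s := {n | IsIdemExp n M}) (exists_isIdemExp M)

theorem IsIdemExp.quotient {n : ℕ} {M : Type} [Monoid M] (h : IsIdemExp n M) (c : Con M) :
    IsIdemExp n c.Quotient := by
  refine ⟨h.1, fun x => ?_⟩
  induction x using Con.induction_on with
  | H x => exact congrArg c.mk' (h.2 x)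

theorem IsIdempotentElem.pow_eq_of_one_le {M : Type} [Monoid M] {e : M}
    (he : IsIdempotentElem e) {n : ℕ} (hn : 1 ≤ n) : e ^ n = e := by
  obtain ⟨k, rfl⟩ := Nat.exists_eq_add_of_le' hn
  exact he.pow_succ_eq k

theorem mul_pow_eq_left {M : Type} [Monoid M] {e a : M} (h : e * a = e) (n : ℕ) :
    e * a ^ n = e := by
  induction n with
  | zero => simp
  | succ n ih => rw [pow_succ, ← mul_assoc, ih, h]

theorem pow_mul_eq_right {M : Type} [Monoid M] {e a : M} (h : a * e = e) (n : ℕ) :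
    a ^ n * e = e := by
  induction n with
  | zero => simp
  | succ n ih => rw [pow_succ, mul_assoc, h, ih]

/-! ## Stabilizers of idempotents -/

/-- The identity `(yt)^n t (yt)^n = (yt)^n`, which defines `DA` when `n` is an idempotent
exponent. -/
def SuffixAbsorbing (n : ℕ) (M : Type) [Monoid M] : Prop :=
  ∀ y t : M, (y * t) ^ n * t * (y * t) ^ n = (y * t) ^ n

theorem SuffixAbsorbing.absorbs_left_factor {n : ℕ} {M : Type} [Monoid M]
    (h : SuffixAbsorbing n M) (hn : IsIdemExp n M) (x y : M) :
    (x * y) ^ n * x * (x * y) ^ n = (x * y) ^ n := by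
  have hxx : (x * y) ^ n * x * ((x * y) ^ n * x) = (x * y) ^ n * x := by
    calc (x * y) ^ n * x * ((x * y) ^ n * x)
        = x * ((y * x) ^ n * x * (y * x) ^ n) := by simp only [mul_pow_mul, mul_assoc]
      _ = (x * y) ^ n * x := by rw [h, mul_pow_mul]
  obtain ⟨k, rfl⟩ := Nat.exists_eq_add_of_le' hn.1
  have he : (x * y) ^ (k + 1) * (x * y) ^ (k + 1) = (x * y) ^ (k + 1) := hn.2 (x * y)
  calc (x * y) ^ (k + 1) * x * (x * y) ^ (k + 1)
      = (x * y) ^ (k + 1) * x * ((x * y) ^ (k + 1) * (x * y) ^ (k + 1)) := by rw [he]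
    _ = (x * y) ^ (k + 1) * x * ((x * y) ^ (k + 1) * x) * (y * (x * y) ^ k) := by
        nth_rewrite 3 [pow_succ']
        simp only [mul_assoc]
    _ = (x * y) ^ (k + 1) * (x * y) ^ (k + 1) := by
        rw [hxx]
        nth_rewrite 3 [pow_succ']
        simp only [mul_assoc]
    _ = (x * y) ^ (k + 1) := he

theorem IsIdemExp.mulOpposite {n : ℕ} {M : Type} [Monoid M] (h : IsIdemExp n M) :
    IsIdemExp n Mᵐᵒᵖ :=
  ⟨h.1, fun x => MulOpposite.unop_injective (h.2 x.unop)⟩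

theorem SuffixAbsorbing.mulOpposite {n : ℕ} {M : Type} [Monoid M] (h : SuffixAbsorbing n M)
    (hn : IsIdemExp n M) : SuffixAbsorbing n Mᵐᵒᵖ := fun y t =>
  MulOpposite.unop_injective <| by
    simpa [mul_assoc] using h.absorbs_left_factor hn t.unop y.unop

/-- `a` does not lead out of the `R`-class of `e`. -/
def RStab {M : Type} [Monoid M] (e a : M) : Prop := ∃ z, e * a * z = e

/-- `a` does not lead out of the `L`-class of `e`. -/
def LStab {M : Type} [Monoid M] (e a : M) : Prop := ∃ z, z * (a * e) = e

theorem rStab_of_rGreen {M : Type} [Monoid M] {e x : M} (h : rGreen (e * x) e) : RStab e x := by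
  have : e ∈ Set.range fun z => e * z := ⟨1, mul_one e⟩
  rwa [← h] at this

theorem lStab_of_lGreen {M : Type} [Monoid M] {e x : M} (h : lGreen (x * e) e) : LStab e x := by
  have : e ∈ Set.range fun z => z * e := ⟨1, one_mul e⟩
  rwa [← h] at this

theorem lStab_iff_op {M : Type} [Monoid M] {e a : M} :
    LStab e a ↔ RStab (MulOpposite.op e) (MulOpposite.op a) :=
  ⟨fun ⟨z, hz⟩ => ⟨MulOpposite.op z, MulOpposite.unop_injective hz⟩,
    fun ⟨z, hz⟩ => ⟨z.unop, congrArg MulOpposite.unop hz⟩⟩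

namespace SuffixAbsorbing

variable {n : ℕ} {M : Type} [Monoid M] {e a b : M}

theorem rStab_mul_iff (h : SuffixAbsorbing n M) (hn : 1 ≤ n) (he : IsIdempotentElem e) :
    RStab e (a * b) ↔ RStab e a ∧ RStab e b := by
  constructor
  · rintro ⟨z, hz⟩
    refine ⟨⟨b * z, by simpa [mul_assoc] using hz⟩, z * (a * (b * z)) ^ n, ?_⟩
    have hg : e * (a * (b * z)) ^ n = e := mul_pow_eq_left (by simpa [mul_assoc] using hz) n
    calc e * b * (z * (a * (b * z)) ^ n)
        = e * (a * (b * z)) ^ n * (b * (z * (a * (b * z)) ^ n)) := by rw [hg, mul_assoc]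
      _ = e * ((a * (b * z)) ^ n * (b * z) * (a * (b * z)) ^ n) := by simp only [mul_assoc]
      _ = e := by rw [h, hg]
  · rintro ⟨⟨z, hz⟩, w, hw⟩
    have hf : z * e * (b * w * a) = z * e * a := by
      calc z * e * (b * w * a) = z * (e * b * w) * a := by simp only [mul_assoc]
        _ = z * e * a := by rw [hw]
    have hea : e * a * (z * e * a) = e * a := by
      calc e * a * (z * e * a) = e * a * z * e * a := by simp only [mul_assoc]
        _ = e * a := by rw [hz, he.eq]
    have hidem : IsIdempotentElem (z * e * a) := by
      calc z * e * a * (z * e * a) = z * (e * a * (z * e * a)) := by simp only [mul_assoc]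
        _ = z * e * a := by rw [hea, mul_assoc]
    have hD := h (z * e) (b * w * a)
    rw [hf, hidem.pow_eq_of_one_le hn] at hD
    refine ⟨w * a * (z * e * a) * z, ?_⟩
    calc e * (a * b) * (w * a * (z * e * a) * z)
        = e * a * (b * w * a * (z * e * a)) * z := by simp only [mul_assoc]
      _ = e * a * (z * e * a) * (b * w * a * (z * e * a)) * z := by rw [hea]
      _ = e * a * (z * e * a * (b * w * a) * (z * e * a)) * z := by simp only [mul_assoc]
      _ = e := by rw [hD, hea, hz]

theorem rStab_pow_iff (h : SuffixAbsorbing n M) (hn : 1 ≤ n) (he : IsIdempotentElem e) {k : ℕ}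
    (hk : k ≠ 0) : RStab e (a ^ k) ↔ RStab e a := by
  induction k, Nat.one_le_iff_ne_zero.2 hk using Nat.le_induction with
  | base => simp
  | succ k hk ih => rw [pow_succ, h.rStab_mul_iff hn he, ih (by omega), and_self]

theorem lStab_mul_iff (h : SuffixAbsorbing n M) (hn : IsIdemExp n M) (he : IsIdempotentElem e) :
    LStab e (a * b) ↔ LStab e a ∧ LStab e b := by
  simp only [lStab_iff_op, MulOpposite.op_mul]
  rw [(h.mulOpposite hn).rStab_mul_iff hn.1 (congrArg MulOpposite.op he), and_comm]

theorem lStab_pow_iff (h : SuffixAbsorbing n M) (hn : IsIdemExp n M) (he : IsIdempotentElem e)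
    {k : ℕ} (hk : k ≠ 0) : LStab e (a ^ k) ↔ LStab e a := by
  simp only [lStab_iff_op, MulOpposite.op_pow]
  exact (h.mulOpposite hn).rStab_pow_iff hn.1 (congrArg MulOpposite.op he) hk

end SuffixAbsorbing

/-! ## The terms `U_m` and `V_m` -/

theorem eval_Uterm_Vterm_congr {M : Type} [Monoid M] {n : ℕ} {f g : UVLetter → M} {m : ℕ}
    (hs : f .s = g .s) (ht : f .t = g .t) (hx : ∀ i ≤ m, f (.x i) = g (.x i))
    (hy : ∀ i ≤ m, f (.y i) = g (.y i)) :
    (Uterm m).eval n f = (Uterm m).eval n g ∧ (Vterm m).eval n f = (Vterm m).eval n g := by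
  induction m with
  | zero => exact ⟨rfl, rfl⟩
  | succ m ih =>
    have ih := ih (fun i hi => hx i (by omega)) (fun i hi => hy i (by omega))
    cases m with
    | zero => simp [Uterm, Vterm, PiTerm.eval, hs, ht, hx 1 le_rfl, hy 1 le_rfl]
    | succ m => simp [Uterm, Vterm, PiTerm.eval, ih, hx (m + 2) le_rfl, hy (m + 2) le_rfl]

/-- The equation `(U_m x_{m+1})^π U_m = (U_m x_{m+1})^π V_m`. -/
def REqHoldsAt (n m : ℕ) (M : Type) [Monoid M] : Prop :=
  EqHoldsAt n
    (PiTerm.mul (PiTerm.pi (PiTerm.mul (Uterm m) (PiTerm.letter (UVLetter.x (m + 1)))))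
      (Uterm m))
    (PiTerm.mul (PiTerm.pi (PiTerm.mul (Uterm m) (PiTerm.letter (UVLetter.x (m + 1)))))
      (Vterm m)) M

/-- The equation `U_m (y_{m+1} U_m)^π = V_m (y_{m+1} U_m)^π`. -/
def LEqHoldsAt (n m : ℕ) (M : Type) [Monoid M] : Prop :=
  EqHoldsAt n
    (PiTerm.mul (Uterm m)
      (PiTerm.pi (PiTerm.mul (PiTerm.letter (UVLetter.y (m + 1))) (Uterm m))))
    (PiTerm.mul (Vterm m)
      (PiTerm.pi (PiTerm.mul (PiTerm.letter (UVLetter.y (m + 1))) (Uterm m)))) M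

section

variable {n m : ℕ} {M : Type} [Monoid M]

theorem exists_eval_Uterm_Vterm (hn : IsIdemExp n M) (y t : M) (m : ℕ) :
    ∃ f : UVLetter → M, f (.x (m + 2)) = 1 ∧ f (.y (m + 2)) = 1 ∧
      (Uterm (m + 1)).eval n f = (y * t) ^ n ∧
      (y * t) ^ n * (Vterm (m + 1)).eval n f * (y * t) ^ n = (y * t) ^ n * t * (y * t) ^ n := by
  let f : UVLetter → M
    | .s => 1
    | .t => t
    | .x _ => 1
    | .y i => if i = 1 then y else 1
  refine ⟨f, rfl, by simp [f], ?_⟩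
  have hF := hn.2 (y * t)
  have hFn := hF.pow_eq_of_one_le hn.1
  have hF' : (y * t) ^ n * (y * t) ^ n = (y * t) ^ n := hF
  induction m with
  | zero => simp [Uterm, Vterm, PiTerm.eval, f, mul_assoc, hF']
  | succ m ih =>
    obtain ⟨hU, hV⟩ := ih
    have hx : f (.x (m + 2)) = 1 := rfl
    have hy : f (.y (m + 2)) = 1 := by simp [f]
    simp only [Uterm, Vterm, PiTerm.eval, hU, hx, hy, mul_one, one_mul, hFn, hF', true_and]
    rw [← hV]
    simp only [mul_assoc, hF']
    simp only [← mul_assoc, hF']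

theorem REqHoldsAt.suffixAbsorbing (hn : IsIdemExp n M) (h : REqHoldsAt n (m + 1) M) :
    SuffixAbsorbing n M := by
  intro y t
  obtain ⟨f, hx, -, hU, hV⟩ := exists_eval_Uterm_Vterm hn y t m
  have hF := hn.2 (y * t)
  have hf := h f
  simp only [PiTerm.eval, hU, hx, mul_one, hF.pow_eq_of_one_le hn.1, hF.eq] at hf
  rw [← hV, ← hf, hF.eq]

theorem LEqHoldsAt.suffixAbsorbing (hn : IsIdemExp n M) (h : LEqHoldsAt n (m + 1) M) :
    SuffixAbsorbing n M := by
  intro y t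
  obtain ⟨f, -, hy, hU, hV⟩ := exists_eval_Uterm_Vterm hn y t m
  have hF := hn.2 (y * t)
  have hf := h f
  simp only [PiTerm.eval, hU, hy, one_mul, hF.pow_eq_of_one_le hn.1, hF.eq] at hf
  rw [← hV, mul_assoc, ← hf, hF.eq]

theorem REqHoldsAt.mul_eval_eq (h : REqHoldsAt n m M) {f : UVLetter → M} {e : M}
    (he : RStab e ((Uterm m).eval n f)) :
    e * (Uterm m).eval n f = e * (Vterm m).eval n f := by
  obtain ⟨z, hz⟩ := he
  let g := Function.update f (.x (m + 1)) z
  have hne : ∀ i ≤ m, i ≠ m + 1 := by omega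
  obtain ⟨hU, hV⟩ := eval_Uterm_Vterm_congr (n := n) (f := g) (g := f) (m := m)
    (by simp [g]) (by simp [g]) (fun i hi => by simp [g, hne i hi]) (fun i hi => by simp [g])
  have hg := congrArg (e * ·) (h g)
  have hx : g (.x (m + 1)) = z := by simp [g]
  simpa only [PiTerm.eval, hU, hV, hx, ← mul_assoc,
    mul_pow_eq_left ((mul_assoc e _ z).symm.trans hz)] using hg

theorem LEqHoldsAt.eval_mul_eq (h : LEqHoldsAt n m M) {f : UVLetter → M} {e : M}
    (he : LStab e ((Uterm m).eval n f)) :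
    (Uterm m).eval n f * e = (Vterm m).eval n f * e := by
  obtain ⟨z, hz⟩ := he
  let g := Function.update f (.y (m + 1)) z
  have hne : ∀ i ≤ m, i ≠ m + 1 := by omega
  obtain ⟨hU, hV⟩ := eval_Uterm_Vterm_congr (n := n) (f := g) (g := f) (m := m)
    (by simp [g]) (by simp [g]) (fun i hi => by simp [g]) (fun i hi => by simp [g, hne i hi])
  have hg := congrArg (· * e) (h g)
  have hy : g (.y (m + 1)) = z := by simp [g]
  simpa only [PiTerm.eval, hU, hV, hy, mul_assoc,
    pow_mul_eq_right ((mul_assoc z _ e).trans hz)] using hg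

/-! ## Passing to the quotients -/

theorem REqHoldsAt.simK_one (hn : IsIdemExp n M) (h : REqHoldsAt n 1 M) (f : UVLetter → M) :
    simK ((Uterm 1).eval n f) ((Vterm 1).eval n f) := by
  intro e he hor
  have hS := h.suffixAbsorbing hn
  have hn0 : n ≠ 0 := by have := hn.1; omega
  refine h.mul_eval_eq ?_
  rcases hor with hr | hr
  · exact rStab_of_rGreen hr
  · have := rStab_of_rGreen hr
    simp only [Uterm, Vterm, PiTerm.eval, hS.rStab_mul_iff hn.1 he,
      hS.rStab_pow_iff hn.1 he hn0] at this ⊢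
    tauto

theorem LEqHoldsAt.simD_one (hn : IsIdemExp n M) (h : LEqHoldsAt n 1 M) (f : UVLetter → M) :
    simD ((Uterm 1).eval n f) ((Vterm 1).eval n f) := by
  intro e he hor
  have hS := h.suffixAbsorbing hn
  have hn0 : n ≠ 0 := by have := hn.1; omega
  refine h.eval_mul_eq ?_
  rcases hor with hl | hl
  · exact lStab_of_lGreen hl
  · have := lStab_of_lGreen hl
    simp only [Uterm, Vterm, PiTerm.eval, hS.lStab_mul_iff hn he,
      hS.lStab_pow_iff hn he hn0] at this ⊢
    tauto

theorem REqHoldsAt.lEqHoldsAt_quotient (hn : IsIdemExp n M) (h : REqHoldsAt n (m + 2) M) :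
    LEqHoldsAt n (m + 1) (KCon M).Quotient := by
  refine Con.eqHoldsAt_quotient _ fun f => ConGen.Rel.of _ _ ?_
  intro e he hor
  have hS := h.suffixAbsorbing hn
  have hn0 : n ≠ 0 := by have := hn.1; omega
  simp only [PiTerm.eval] at hor ⊢
  obtain ⟨z, hz⟩ : RStab e ((Uterm (m + 1)).eval n f *
      (f (.y (m + 2)) * (Uterm (m + 1)).eval n f) ^ n) := by
    rcases hor with hr | hr
    · exact rStab_of_rGreen hr
    · have := rStab_of_rGreen hr
      simp only [hS.rStab_mul_iff hn.1 he, hS.rStab_pow_iff hn.1 he hn0] at this ⊢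
      tauto
  let g := Function.update f (.x (m + 2)) ((f (.y (m + 2)) * (Uterm (m + 1)).eval n f) ^ n * z)
  have hne : ∀ i ≤ m + 1, i ≠ m + 2 := by omega
  obtain ⟨hU, hV⟩ := eval_Uterm_Vterm_congr (n := n) (f := g) (g := f) (m := m + 1)
    (by simp [g]) (by simp [g]) (fun i hi => by simp [g, hne i hi]) (fun i hi => by simp [g])
  have hx : g (.x (m + 2)) = (f (.y (m + 2)) * (Uterm (m + 1)).eval n f) ^ n * z := by simp [g]
  have hy : g (.y (m + 2)) = f (.y (m + 2)) := by simp [g]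
  have hfix := mul_pow_eq_left (n := n) (e := e)
    (a := (Uterm (m + 1)).eval n f * ((f (.y (m + 2)) * (Uterm (m + 1)).eval n f) ^ n * z))
    (by simpa only [mul_assoc] using hz)
  have hU' : e * (Uterm (m + 2)).eval n g = e * ((Uterm (m + 1)).eval n f *
      (f (.y (m + 2)) * (Uterm (m + 1)).eval n f) ^ n) := by
    simp only [Uterm, PiTerm.eval, hU, hx, hy]
    rw [← mul_assoc, hfix]
  have hV' : e * (Vterm (m + 2)).eval n g = e * ((Vterm (m + 1)).eval n f *
      (f (.y (m + 2)) * (Uterm (m + 1)).eval n f) ^ n) := by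
    simp only [Vterm, PiTerm.eval, hU, hV, hx, hy]
    rw [← mul_assoc, hfix]
  rw [← hU', ← hV']
  exact h.mul_eval_eq ⟨z, by rw [hU', hz]⟩

theorem LEqHoldsAt.rEqHoldsAt_quotient (hn : IsIdemExp n M) (h : LEqHoldsAt n (m + 2) M) :
    REqHoldsAt n (m + 1) (DCon M).Quotient := by
  refine Con.eqHoldsAt_quotient _ fun f => ConGen.Rel.of _ _ ?_
  intro e he hor
  have hS := h.suffixAbsorbing hn
  have hn0 : n ≠ 0 := by have := hn.1; omega
  simp only [PiTerm.eval] at hor ⊢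
  obtain ⟨z, hz⟩ : LStab e (((Uterm (m + 1)).eval n f * f (.x (m + 2))) ^ n *
      (Uterm (m + 1)).eval n f) := by
    rcases hor with hl | hl
    · exact lStab_of_lGreen hl
    · have := lStab_of_lGreen hl
      simp only [hS.lStab_mul_iff hn he, hS.lStab_pow_iff hn he hn0] at this ⊢
      tauto
  let g := Function.update f (.y (m + 2)) (z * ((Uterm (m + 1)).eval n f * f (.x (m + 2))) ^ n)
  have hne : ∀ i ≤ m + 1, i ≠ m + 2 := by omega
  obtain ⟨hU, hV⟩ := eval_Uterm_Vterm_congr (n := n) (f := g) (g := f) (m := m + 1)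
    (by simp [g]) (by simp [g]) (fun i hi => by simp [g]) (fun i hi => by simp [g, hne i hi])
  have hy : g (.y (m + 2)) = z * ((Uterm (m + 1)).eval n f * f (.x (m + 2))) ^ n := by simp [g]
  have hx : g (.x (m + 2)) = f (.x (m + 2)) := by simp [g]
  have hfix := pow_mul_eq_right (n := n) (e := e)
    (a := z * ((Uterm (m + 1)).eval n f * f (.x (m + 2))) ^ n * (Uterm (m + 1)).eval n f)
    (by simpa only [mul_assoc] using hz)
  have hU' : (Uterm (m + 2)).eval n g * e = ((Uterm (m + 1)).eval n f * f (.x (m + 2))) ^ n *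
      (Uterm (m + 1)).eval n f * e := by
    simp only [Uterm, PiTerm.eval, hU, hx, hy]
    rw [mul_assoc, mul_assoc, hfix, mul_assoc]
  have hV' : (Vterm (m + 2)).eval n g * e = ((Uterm (m + 1)).eval n f * f (.x (m + 2))) ^ n *
      (Vterm (m + 1)).eval n f * e := by
    simp only [Vterm, PiTerm.eval, hU, hV, hx, hy]
    rw [mul_assoc, mul_assoc, hfix, mul_assoc]
  rw [← hU', ← hV']
  exact h.eval_mul_eq ⟨z, by rw [hU', hz]⟩

theorem EqHoldsAt.isJTrivial (h : EqHoldsAt n (Uterm 1) (Vterm 1) M) : IsJTrivial M := by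
  have hR : ∀ a b : M, (a * b) ^ n * a = (a * b) ^ n := fun a b => by
    simpa [Uterm, Vterm, PiTerm.eval] using h
      fun | .s => a | .t => 1 | .x _ => b | .y _ => 1
  have hL : ∀ a b : M, a * (b * a) ^ n = (b * a) ^ n := fun a b => by
    simpa [Uterm, Vterm, PiTerm.eval] using (h
      fun | .s => 1 | .t => a | .x _ => 1 | .y _ => b).symm
  intro a b hab
  obtain ⟨p, q, ha⟩ : ∃ p q, a = p * b * q := by
    have : a ∈ {z | ∃ p q, z = p * a * q} := ⟨1, 1, by simp⟩
    rwa [hab] at this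
  obtain ⟨r, s, hb⟩ : ∃ r s, b = r * a * s := by
    have : b ∈ {z | ∃ p q, z = p * b * q} := ⟨1, 1, by simp⟩
    rwa [← hab] at this
  have hstep : a = p * r * a * (s * q) := by
    nth_rewrite 1 [ha, hb]
    simp only [mul_assoc]
  have hpow : ∀ k : ℕ, a = (p * r) ^ k * a * (s * q) ^ k := by
    intro k
    induction k with
    | zero => simp
    | succ k ih =>
      calc a = (p * r) ^ k * a * (s * q) ^ k := ih
        _ = (p * r) ^ k * (p * r * a * (s * q)) * (s * q) ^ k := by rw [← hstep]
        _ = (p * r) ^ (k + 1) * a * (s * q) ^ (k + 1) := by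
          rw [pow_succ (p * r), pow_succ' (s * q)]
          simp only [mul_assoc]
  symm
  calc b = r * ((p * r) ^ n * a * (s * q) ^ n) * s := by rw [← hpow, ← hb]
    _ = r * (p * r) ^ n * a * ((s * q) ^ n * s) := by simp only [mul_assoc]
    _ = a := by rw [hL, hR, ← hpow]

end

theorem inRLAux_of_eqHoldsAt {n : ℕ} (m : ℕ) : ∀ (M : Type) [i : Monoid M], IsIdemExp n M →
    (REqHoldsAt n (m + 1) M → InRLAux (m + 1) true M i) ∧
    (LEqHoldsAt n (m + 1) M → InRLAux (m + 1) false M i) := by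
  induction m with
  | zero =>
    exact fun M _ hn => ⟨
      fun h => EqHoldsAt.isJTrivial (Con.eqHoldsAt_quotient (KCon M) fun f =>
        ConGen.Rel.of _ _ (h.simK_one hn f)),
      fun h => EqHoldsAt.isJTrivial (Con.eqHoldsAt_quotient (DCon M) fun f =>
        ConGen.Rel.of _ _ (h.simD_one hn f))⟩
  | succ m ih =>
    exact fun M _ hn => ⟨
      fun h => (ih (KCon M).Quotient (hn.quotient _)).2 (h.lEqHoldsAt_quotient hn),
      fun h => (ih (DCon M).Quotient (hn.quotient _)).1 (h.rEqHoldsAt_quotient hn)⟩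

/-- Lemma 1 (equational characterization, sufficiency direction). -/
theorem trotterWeil_equations (M : Type) [Monoid M] [Finite M] (m : ℕ) (hm : 1 ≤ m) :
    (EqHoldsIn (Uterm 1) (Vterm 1) M → IsJTrivial M) ∧
    (EqHoldsIn
        (PiTerm.mul (PiTerm.pi (PiTerm.mul (Uterm m) (PiTerm.letter (UVLetter.x (m + 1)))))
          (Uterm m))
        (PiTerm.mul (PiTerm.pi (PiTerm.mul (Uterm m) (PiTerm.letter (UVLetter.x (m + 1)))))
          (Vterm m)) M →
      InRm (m + 1) M) ∧
    (EqHoldsIn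
        (PiTerm.mul (Uterm m)
          (PiTerm.pi (PiTerm.mul (PiTerm.letter (UVLetter.y (m + 1))) (Uterm m))))
        (PiTerm.mul (Vterm m)
          (PiTerm.pi (PiTerm.mul (PiTerm.letter (UVLetter.y (m + 1))) (Uterm m)))) M →
      InLm (m + 1) M) ∧
    (EqHoldsIn (Uterm m) (Vterm m) M → InRm (m + 1) M ∧ InLm (m + 1) M) := by
  obtain ⟨k, rfl⟩ := Nat.exists_eq_add_of_le' hm
  have hmain := inRLAux_of_eqHoldsAt k M (isIdemExp_monoidExp M)
  refine ⟨fun h => h.eqHoldsAt.isJTrivial, fun h => hmain.1 h.eqHoldsAt,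
    fun h => hmain.2 h.eqHoldsAt, fun h => ⟨hmain.1 fun f => ?_, hmain.2 fun f => ?_⟩⟩
  · simp only [PiTerm.eval, h.eqHoldsAt f]
  · simp only [PiTerm.eval, h.eqHoldsAt f]
end

section
/- Let M be a finite monoid in DA and let s, t, a ∈ M with s R t. If s R sa, then t R ta. -/
open scoped Classical

theorem mul_pow_eq_of_mul_eq {M : Type} [Monoid M] {t w : M} (h : t * w = t) (n : ℕ) :
    t * w ^ n = t := by
  induction n with
  | zero => simp
  | succ n ih => rw [pow_succ, ← mul_assoc, ih, h]

theorem rGreen_iff {M : Type} [Monoid M] {x y : M} :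
    rGreen x y ↔ (∃ z, x * z = y) ∧ ∃ z, y * z = x := by
  constructor
  · intro h
    unfold rGreen at h
    constructor
    · have hy : y ∈ Set.range (fun z => y * z) := ⟨1, mul_one y⟩
      rwa [← h] at hy
    · have hx : x ∈ Set.range (fun z => x * z) := ⟨1, mul_one x⟩
      rwa [h] at hx
  · rintro ⟨⟨u, rfl⟩, v, hv⟩
    ext m
    constructor
    · rintro ⟨z, rfl⟩
      exact ⟨v * z, by simp only [← mul_assoc, hv]⟩
    · rintro ⟨z, rfl⟩
      exact ⟨u * z, (mul_assoc x u z).symm⟩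

/-- Lemma: in a finite monoid in DA, falling out of an R-class is determined by letters. -/
theorem rDescend_in_DA (M : Type) [Monoid M] [Finite M] (hM : InDA M) (s t a : M)
    (hst : rGreen s t) (h : rGreen s (s * a)) : rGreen t (t * a) := by
  obtain ⟨⟨v, hv⟩, u, hu⟩ := rGreen_iff.mp hst
  obtain ⟨-, b, hb⟩ := rGreen_iff.mp h
  have ht : t * (u * a * (b * v)) = t := by
    simp only [← mul_assoc]
    rw [hu, hb, hv]
  have hte := mul_pow_eq_of_mul_eq ht (monoidExp M)
  refine rGreen_iff.mpr ⟨⟨a, rfl⟩, (u * a * (b * v)) ^ monoidExp M, ?_⟩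
  have hDA := congrArg (t * ·) (hM u a (b * v))
  simpa only [← mul_assoc t, hte] using hDA
end

section
/- Let M be a finite monoid, φ : Σ* → M a monoid homomorphism from the free monoid over a finite alphabet Σ, and m ∈ ℕ. Then: (i) if M ∈ R_m, there exists n ∈ ℕ such that for all u, v ∈ Σ*, u ≡_{m,n}^X v implies φ(u) = φ(v); (ii) if M ∈ L_m, there exists n ∈ ℕ such that for all u, v ∈ Σ*, u ≡_{m,n}^Y v implies φ(u) = φ(v); (iii) if M ∈ R_m ∨ L_m, there exists n ∈ ℕ such that for all u, v ∈ Σ*, u ≡_{m,n}^{XY} v implies φ(u) = φ(v); (iv) if M ∈ R_{m+1} ∩ L_{m+1}, there exists n ∈ ℕ such that for all u, v ∈ Σ*, u ≡_{m,n}^{WI} v implies φ(u) = φ(v). -/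
open scoped Classical

/-! ## Green's relations and idempotents -/

lemma exists_pow_idem {M : Type} [Monoid M] [Finite M] (x : M) :
    ∃ k, IsIdempotentElem (x ^ (k + 1)) := by
  obtain ⟨i, j, hij, h⟩ := Finite.exists_ne_map_eq_of_infinite (fun n : ℕ => x ^ (n + 1))
  wlog hlt : i < j generalizing i j
  · exact this j i hij.symm h.symm (by omega)
  obtain ⟨d, rfl⟩ := Nat.exists_eq_add_of_lt hlt
  have step : ∀ t, i + 1 ≤ t → x ^ (t + (d + 1)) = x ^ t := by
    intro t ht
    obtain ⟨c, rfl⟩ := Nat.exists_eq_add_of_le ht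
    rw [show i + 1 + c + (d + 1) = i + d + 1 + 1 + c by ring, pow_add, ← h, ← pow_add]
  have steps : ∀ q t, i + 1 ≤ t → x ^ (t + q * (d + 1)) = x ^ t := by
    intro q
    induction q with
    | zero => simp
    | succ q ih =>
      intro t ht
      rw [show t + (q + 1) * (d + 1) = t + q * (d + 1) + (d + 1) by ring,
        step _ (by omega), ih t ht]
  refine ⟨i * (d + 1) + d, ?_⟩
  have hk : i * (d + 1) + d + 1 = (i + 1) * (d + 1) := by ring
  have hle : i + 1 ≤ (i + 1) * (d + 1) := Nat.le_mul_of_pos_right _ (Nat.succ_pos d)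
  rw [IsIdempotentElem, hk, ← pow_add, steps (i + 1) _ hle]

lemma rGreen_mul_left_iff {M : Type} [Monoid M] (e x : M) :
    rGreen (e * x) e ↔ ∃ r, e * x * r = e := by
  constructor
  · intro h
    have : e ∈ Set.range (fun z => e * z) := ⟨1, mul_one e⟩
    rw [← h] at this
    exact this
  · rintro ⟨r, hr⟩
    apply Set.Subset.antisymm
    · rintro _ ⟨z, rfl⟩
      exact ⟨x * z, by simp [mul_assoc]⟩
    · rintro _ ⟨z, rfl⟩
      exact ⟨r * z, by simp only [← mul_assoc, hr]⟩

lemma lGreen_mul_right_iff {M : Type} [Monoid M] (e x : M) :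
    lGreen (x * e) e ↔ ∃ r, r * (x * e) = e := by
  constructor
  · intro h
    have : e ∈ Set.range (fun z => z * e) := ⟨1, one_mul e⟩
    rw [← h] at this
    exact this
  · rintro ⟨r, hr⟩
    apply Set.Subset.antisymm
    · rintro _ ⟨z, rfl⟩
      exact ⟨z * x, by simp [mul_assoc]⟩
    · rintro _ ⟨z, rfl⟩
      exact ⟨z * r, by simp only [mul_assoc, hr]⟩

lemma simK_iff {M : Type} [Monoid M] (x y : M) : simK x y ↔ ∀ e : M, e * e = e →
    ((∃ r, e * x * r = e) ∨ ∃ r, e * y * r = e) → e * x = e * y := by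
  simp only [simK, rGreen_mul_left_iff, IsIdempotentElem]

lemma simD_iff {M : Type} [Monoid M] (x y : M) : simD x y ↔ ∀ e : M, e * e = e →
    ((∃ r, r * (x * e) = e) ∨ ∃ r, r * (y * e) = e) → x * e = y * e := by
  simp only [simD, lGreen_mul_right_iff, IsIdempotentElem]

lemma simD_iff_simK_op {M : Type} [Monoid M] (x y : M) :
    simD x y ↔ simK (MulOpposite.op x) (MulOpposite.op y) := by
  rw [simD_iff, simK_iff]
  simp only [MulOpposite.forall, MulOpposite.exists, ← MulOpposite.op_mul, MulOpposite.op_inj]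

/-- If `s * w = s`, then `s` is fixed by an idempotent which is a positive power of `w`. -/
lemma exists_idem_right {M : Type} [Monoid M] [Finite M] {s w : M} (h : s * w = s) :
    ∃ e c : M, e * e = e ∧ e = w * c ∧ s * e = s := by
  obtain ⟨k, hk⟩ := exists_pow_idem w
  refine ⟨w ^ (k + 1), w ^ k, hk, pow_succ' w k, ?_⟩
  have : ∀ j, s * w ^ j = s := by
    intro j
    induction j with
    | zero => simp
    | succ j ih => rw [pow_succ, ← mul_assoc, ih, h]
  exact this _

lemma exists_idem_left {M : Type} [Monoid M] [Finite M] {t w : M} (h : w * t = t) :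
    ∃ e c : M, e * e = e ∧ e = c * w ∧ e * t = t := by
  obtain ⟨k, hk⟩ := exists_pow_idem w
  refine ⟨w ^ (k + 1), w ^ k, hk, pow_succ w k, ?_⟩
  have : ∀ j, w ^ j * t = t := by
    intro j
    induction j with
    | zero => simp
    | succ j ih => rw [pow_succ, mul_assoc, h, ih]
  exact this _

/-! ## The congruences `∼_K` and `∼_D` -/

lemma simK_symm {M : Type} [Monoid M] {x y : M} (h : simK x y) : simK y x :=
  fun e he hr => (h e he hr.symm).symm

lemma simK_mul_right {M : Type} [Monoid M] {x y : M} (h : simK x y) (z : M) :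
    simK (x * z) (y * z) := by
  rw [simK_iff] at h ⊢
  rintro e he (⟨r, hr⟩ | ⟨r, hr⟩)
  · rw [← mul_assoc, h e he (.inl ⟨z * r, by simpa only [mul_assoc] using hr⟩), mul_assoc]
  · rw [← mul_assoc, h e he (.inr ⟨z * r, by simpa only [mul_assoc] using hr⟩), mul_assoc]

/-- Right multiplication by `x` and `y` agrees at every point that `x` keeps in its `R`-class. -/
lemma simK.mul_eq {M : Type} [Monoid M] [Finite M] {x y : M} (h : simK x y) {s r : M}
    (hr : s * x * r = s) : s * x = s * y := by
  obtain ⟨e, c, he, hc, hs⟩ := exists_idem_right (s := s) (w := x * r) (by rw [← mul_assoc, hr])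
  rw [simK_iff] at h
  have := h e he (.inl ⟨r * c, by rw [mul_assoc, ← mul_assoc x, ← hc, he]⟩)
  rw [← hs, mul_assoc, this, mul_assoc]

lemma simK_mul_left {M : Type} [Monoid M] [Finite M] {x y : M} (h : simK x y) (z : M) :
    simK (z * x) (z * y) := by
  rw [simK_iff]
  rintro e he (⟨r, hr⟩ | ⟨r, hr⟩)
  · rw [← mul_assoc, ← mul_assoc]
    refine h.mul_eq (r := r * z) ?_
    rw [← mul_assoc, mul_assoc e, hr]
  · rw [← mul_assoc, ← mul_assoc]
    refine ((simK_symm h).mul_eq (r := r * z) ?_).symm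
    rw [← mul_assoc, mul_assoc e, hr]

instance {M : Type} [Finite M] : Finite Mᵐᵒᵖ := .of_equiv M MulOpposite.opEquiv

lemma simD_symm {M : Type} [Monoid M] {x y : M} (h : simD x y) : simD y x :=
  fun e he hr => (h e he hr.symm).symm

lemma simD_mul_left {M : Type} [Monoid M] {x y : M} (h : simD x y) (z : M) :
    simD (z * x) (z * y) := by
  rw [simD_iff_simK_op] at h ⊢
  exact simK_mul_right h _

lemma simD_mul_right {M : Type} [Monoid M] [Finite M] {x y : M} (h : simD x y) (z : M) :
    simD (x * z) (y * z) := by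
  rw [simD_iff_simK_op] at h ⊢
  exact simK_mul_left h _

lemma simD.mul_eq {M : Type} [Monoid M] [Finite M] {x y : M} (h : simD x y) {t r : M}
    (hr : r * (x * t) = t) : x * t = y * t := by
  rw [simD_iff_simK_op] at h
  have := h.mul_eq (s := MulOpposite.op t) (r := MulOpposite.op r)
    (by simp only [← MulOpposite.op_mul, hr])
  simpa only [← MulOpposite.op_mul, MulOpposite.op_inj] using this

lemma conGen_le_apply {M : Type} [Mul M] {r : M → M → Prop} (C : Con M)
    (hr : ∀ x y, r x y → C x y) {x y : M} (h : conGen r x y) : C x y :=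
  Con.conGen_le.2 hr h

/-- The congruence generated by a relation stable under translations is its equivalence
closure. -/
def stableCon {M : Type} [Monoid M] (r : M → M → Prop)
    (hl : ∀ x y z, r x y → r (z * x) (z * y)) (hr : ∀ x y z, r x y → r (x * z) (y * z)) :
    Con M where
  toSetoid := Relation.EqvGen.setoid r
  mul' := by
    intro w x y z hwx hyz
    refine Relation.EqvGen.trans _ (x * y) _ ?_ ?_
    · induction hwx with
      | rel _ _ h => exact .rel _ _ (hr _ _ _ h)
      | refl => exact .refl _
      | symm _ _ _ ih => exact .symm _ _ ih
      | trans _ _ _ _ _ ih ih' => exact .trans _ _ _ ih ih'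
    · induction hyz with
      | rel _ _ h => exact .rel _ _ (hl _ _ _ h)
      | refl => exact .refl _
      | symm _ _ _ ih => exact .symm _ _ ih
      | trans _ _ _ _ _ ih ih' => exact .trans _ _ _ ih ih'

lemma simK_trans {M : Type} [Monoid M] {x y z : M} (h : simK x y) (h' : simK y z) :
    simK x z := by
  rw [simK_iff] at h h' ⊢
  rintro e he (hr | hr)
  · have := h e he (.inl hr)
    rw [this, h' e he (.inl (this ▸ hr))]
  · have := h' e he (.inr hr)
    rw [← this, h e he (.inr (this ▸ hr))]

lemma KCon_iff {M : Type} [Monoid M] [Finite M] {x y : M} : KCon M x y ↔ simK x y := by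
  refine ⟨fun h => ?_, fun h => .of _ _ h⟩
  let C : Con M :=
    { r := simK
      iseqv := ⟨fun _ _ _ _ => rfl, simK_symm, simK_trans⟩
      mul' := fun h h' => simK_trans (simK_mul_right h _) (simK_mul_left h' _) }
  exact conGen_le_apply C (fun _ _ h => h) h

lemma simD_trans {M : Type} [Monoid M] {x y z : M} (h : simD x y) (h' : simD y z) :
    simD x z := by
  rw [simD_iff_simK_op] at h h' ⊢
  exact simK_trans h h'

lemma DCon_iff {M : Type} [Monoid M] [Finite M] {x y : M} : DCon M x y ↔ simD x y := by
  refine ⟨fun h => ?_, fun h => .of _ _ h⟩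
  let C : Con M :=
    { r := simD
      iseqv := ⟨fun _ _ _ _ => rfl, simD_symm, simD_trans⟩
      mul' := fun h h' => simD_trans (simD_mul_right h _) (simD_mul_left h' _) }
  exact conGen_le_apply C (fun _ _ h => h) h

instance {M : Type} [Monoid M] [Finite M] (C : Con M) : Finite C.Quotient :=
  Quotient.finite _

/-! ## Quotients of monoids in the Trotter–Weil hierarchy -/

/-- `R`-stability at an idempotent lifts along surjective homomorphisms of finite monoids. -/
lemma exists_idem_lift {N N' : Type} [Monoid N] [Monoid N'] [Finite N] (f : N →* N')
    (hf : Function.Surjective f) {e' r' : N'} {x : N} (he : e' * e' = e')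
    (hr : e' * f x * r' = e') : ∃ e r : N, e * e = e ∧ f e = e' ∧ e * x * r = e := by
  have hpow : ∀ k, e' ^ (k + 1) = e' := fun k => IsIdempotentElem.pow_succ_eq k he
  obtain ⟨r, rfl⟩ := hf r'
  let S : Set N := {e | e * e = e ∧ f e = e'}
  have hS : S.Nonempty := by
    obtain ⟨z, hz⟩ := hf e'
    obtain ⟨k, hk⟩ := exists_pow_idem z
    exact ⟨z ^ (k + 1), hk, by rw [map_pow, hz, hpow]⟩
  obtain ⟨e, ⟨hee, hfe⟩, hmin⟩ := Set.exists_min_image S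
    (fun e => (Set.range (fun z => e * z)).ncard) (Set.toFinite _) hS
  obtain ⟨k, hk⟩ := exists_pow_idem (e * x * r * e)
  have hfg : f ((e * x * r * e) ^ (k + 1)) = e' := by
    rw [map_pow, map_mul, map_mul, map_mul, hfe, hr, he, hpow]
  have hle := hmin _ ⟨hk, hfg⟩
  have hsub : Set.range (fun z => (e * x * r * e) ^ (k + 1) * z) ⊆
      Set.range (fun z => e * z) := by
    rintro _ ⟨z, rfl⟩
    exact ⟨x * r * e * (e * x * r * e) ^ k * z, by simp only [pow_succ', mul_assoc]⟩
  have heq := Set.eq_of_subset_of_ncard_le hsub hle (Set.toFinite _)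
  obtain ⟨c, hc⟩ : e ∈ Set.range (fun z => (e * x * r * e) ^ (k + 1) * z) :=
    heq ▸ ⟨1, mul_one e⟩
  refine ⟨e, r * e * (e * x * r * e) ^ k * c, hee, hfe, ?_⟩
  calc _ = (e * x * r * e) ^ (k + 1) * c := by simp only [pow_succ', mul_assoc]
    _ = e := hc

lemma simK_map {N N' : Type} [Monoid N] [Monoid N'] [Finite N] (f : N →* N')
    (hf : Function.Surjective f) {x y : N} (h : simK x y) : simK (f x) (f y) := by
  rw [simK_iff] at h ⊢
  rintro e' he' (⟨r', hr⟩ | ⟨r', hr⟩)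
  · obtain ⟨e, r, he, rfl, h1⟩ := exists_idem_lift f hf he' hr
    rw [← map_mul, ← map_mul, h e he (.inl ⟨r, h1⟩)]
  · obtain ⟨e, r, he, rfl, h1⟩ := exists_idem_lift f hf he' hr
    rw [← map_mul, ← map_mul, h e he (.inr ⟨r, h1⟩)]

lemma simD_map {N N' : Type} [Monoid N] [Monoid N'] [Finite N] (f : N →* N')
    (hf : Function.Surjective f) {x y : N} (h : simD x y) : simD (f x) (f y) := by
  rw [simD_iff_simK_op] at h ⊢
  exact simK_map (MonoidHom.op f)
    (fun z => let ⟨w, hw⟩ := hf z.unop; ⟨MulOpposite.op w, by simp [hw]⟩) h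

/-- The homomorphism between quotients induced by a homomorphism. -/
lemma exists_quotient_map {N N' : Type} [Monoid N] [Monoid N'] (f : N →* N')
    (hf : Function.Surjective f) (C : Con N) (C' : Con N')
    (h : ∀ x y, C x y → C' (f x) (f y)) :
    ∃ g : C.Quotient →* C'.Quotient, Function.Surjective g := by
  refine ⟨C.lift (C'.mk'.comp f) fun x y hxy => (Con.eq C').2 (h x y hxy), fun z => ?_⟩
  obtain ⟨z, rfl⟩ := Con.mk'_surjective z
  obtain ⟨w, rfl⟩ := hf z
  exact ⟨(w : C.Quotient), rfl⟩

lemma IsJTrivial.mul_right_eq {M : Type} [Monoid M] (hM : IsJTrivial M) {s x r : M}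
    (h : s * x * r = s) : s * x = s := by
  apply hM
  ext z
  constructor
  · rintro ⟨a, b, rfl⟩
    exact ⟨a, x * b, by simp only [mul_assoc]⟩
  · rintro ⟨a, b, rfl⟩
    exact ⟨a, r * b, by
      conv_lhs => rw [← h]
      simp only [mul_assoc]⟩

lemma IsJTrivial.mul_left_eq {M : Type} [Monoid M] (hM : IsJTrivial M) {t x r : M}
    (h : r * (x * t) = t) : x * t = t := by
  apply hM
  ext z
  constructor
  · rintro ⟨a, b, rfl⟩
    exact ⟨a * x, b, by simp only [mul_assoc]⟩
  · rintro ⟨a, b, rfl⟩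
    exact ⟨a * r, b, by
      conv_lhs => rw [← h]
      simp only [mul_assoc]⟩

lemma IsJTrivial.map {N N' : Type} [Monoid N] [Monoid N'] [Finite N] (f : N →* N')
    (hf : Function.Surjective f) (hN : IsJTrivial N) : IsJTrivial N' := by
  intro x' y' h
  have hx : x' ∈ {z | ∃ a b, z = a * y' * b} := h ▸ ⟨1, 1, by simp⟩
  have hy : y' ∈ {z | ∃ a b, z = a * x' * b} := h ▸ ⟨1, 1, by simp⟩
  obtain ⟨a', b', hx⟩ := hx
  obtain ⟨c', d', hy⟩ := hy
  obtain ⟨a, rfl⟩ := hf a'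
  obtain ⟨b, rfl⟩ := hf b'
  obtain ⟨c, rfl⟩ := hf c'
  obtain ⟨d, rfl⟩ := hf d'
  have hxx : ∀ k, x' = f (a * c) ^ k * x' * f (d * b) ^ k := by
    intro k
    induction k with
    | zero => simp
    | succ k ih =>
      calc x' = f a * (f c * x' * f d) * f b := by rw [← hy, ← hx]
        _ = f a * f c * x' * (f d * f b) := by simp only [mul_assoc]
        _ = f a * f c * (f (a * c) ^ k * x' * f (d * b) ^ k) * (f d * f b) := by rw [← ih]
        _ = _ := by rw [pow_succ', pow_succ]; simp only [map_mul, mul_assoc]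
  obtain ⟨k, hk⟩ := exists_pow_idem (a * c)
  obtain ⟨l, hl⟩ := exists_pow_idem (d * b)
  have hce : c * (a * c) ^ (k + 1) = (a * c) ^ (k + 1) := by
    refine hN.mul_left_eq (r := (a * c) ^ k * a) ?_
    rw [← mul_assoc, mul_assoc _ a, ← pow_succ, hk.eq]
  have hdf : (d * b) ^ (l + 1) * d = (d * b) ^ (l + 1) := by
    refine hN.mul_right_eq (r := b * (d * b) ^ l) ?_
    rw [← mul_assoc, mul_assoc _ d, mul_assoc, ← pow_succ', hl.eq]
  have hX : x' = f ((a * c) ^ (k + 1)) * x' * f ((d * b) ^ (l + 1)) := by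
    have := hxx ((k + 1) * (l + 1))
    rwa [← map_pow, ← map_pow, pow_mul, hk.pow_succ_eq, mul_comm (k + 1), pow_mul,
      hl.pow_succ_eq] at this
  rw [hy, hX]
  simp only [mul_assoc, ← map_mul, hdf]
  simp only [← mul_assoc, ← map_mul, hce]

/-- Membership in the levels of the Trotter–Weil hierarchy passes to homomorphic images. -/
lemma InRLAux_map : ∀ (k : ℕ) (b : Bool) (N N' : Type) (i : Monoid N) (i' : Monoid N')
    [Finite N] (f : N →* N'), Function.Surjective f → InRLAux k b N i → InRLAux k b N' i'
  | 0, true, _, _, _, _, _, f, hf, h => IsJTrivial.map f hf h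
  | 0, false, _, _, _, _, _, f, hf, h => IsJTrivial.map f hf h
  | k + 1, true, N, N', i, i', _, f, hf, h => by
    have : Finite N' := Finite.of_surjective f hf
    obtain ⟨g, hg⟩ := exists_quotient_map f hf (KCon N) (KCon N')
      (fun x y h => KCon_iff.2 (simK_map f hf (KCon_iff.1 h)))
    exact InRLAux_map k false _ _ _ _ g hg h
  | k + 1, false, N, N', i, i', _, f, hf, h => by
    have : Finite N' := Finite.of_surjective f hf
    obtain ⟨g, hg⟩ := exists_quotient_map f hf (DCon N) (DCon N')
      (fun x y h => DCon_iff.2 (simD_map f hf (DCon_iff.1 h)))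
    exact InRLAux_map k true _ _ _ _ g hg h

/-! ## The `DA` property -/

/-- Every factor `y` of an idempotent `e` satisfies `e * y * e = e`. -/
def FactorAbsorbing (M : Type) [Monoid M] : Prop :=
  ∀ x y z : M, x * y * z * (x * y * z) = x * y * z → x * y * z * y * (x * y * z) = x * y * z

lemma FactorAbsorbing.of_jTrivial {M : Type} [Monoid M] (hM : IsJTrivial M) :
    FactorAbsorbing M := by
  intro x y z he
  have h1 : x * y * z * x = x * y * z :=
    hM.mul_right_eq (r := y * z) (by simpa only [mul_assoc] using he)
  have h2 : x * y * z * (x * y) = x * y * z :=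
    hM.mul_right_eq (r := z) (by simpa only [mul_assoc] using he)
  have h3 : x * y * z * y = x * y * z := by
    rw [← mul_assoc _ x, h1] at h2
    exact h2
  rw [h3, he]

lemma FactorAbsorbing.of_KCon {M : Type} [Monoid M] [Finite M]
    (h : FactorAbsorbing (KCon M).Quotient) : FactorAbsorbing M := by
  intro x y z he
  have := h (x : (KCon M).Quotient) y z (by simp only [← Con.coe_mul, he])
  simp only [← Con.coe_mul] at this
  rw [Con.eq, KCon_iff, simK_iff] at this
  have := this _ he (.inr ⟨1, by rw [he, mul_one]⟩)
  rwa [he, ← mul_assoc, ← mul_assoc _ (x * y * z), he] at this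

lemma FactorAbsorbing.of_DCon {M : Type} [Monoid M] [Finite M]
    (h : FactorAbsorbing (DCon M).Quotient) : FactorAbsorbing M := by
  intro x y z he
  have := h (x : (DCon M).Quotient) y z (by simp only [← Con.coe_mul, he])
  simp only [← Con.coe_mul] at this
  rw [Con.eq, DCon_iff, simD_iff] at this
  have := this _ he (.inr ⟨1, by rw [he, one_mul]⟩)
  rwa [mul_assoc _ (x * y * z) (x * y * z), he] at this

lemma FactorAbsorbing.of_InRLAux : ∀ (k : ℕ) (b : Bool) (M : Type) (i : Monoid M) [Finite M],
    InRLAux k b M i → FactorAbsorbing M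
  | 0, true, _, _, _, h => .of_jTrivial h
  | 0, false, _, _, _, h => .of_jTrivial h
  | k + 1, true, _, _, _, h => .of_KCon (of_InRLAux k false _ _ h)
  | k + 1, false, _, _, _, h => .of_DCon (of_InRLAux k true _ _ h)

/-- If `x * a * y` fixes `s` from the right, then `a` keeps `s` in its `R`-class. -/
lemma FactorAbsorbing.right {M : Type} [Monoid M] [Finite M] (hM : FactorAbsorbing M)
    {s x a y : M} (h : s * (x * a * y) = s) : ∃ r, s * a * r = s := by
  obtain ⟨e, c, he, hc, hs⟩ := exists_idem_right h
  have hc' : e = x * a * (y * c) := by rw [hc, mul_assoc (x * a)]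
  have := hM x a (y * c) (by rw [← hc', he])
  rw [← hc'] at this
  exact ⟨e, by rw [← hs, mul_assoc, mul_assoc, ← mul_assoc e, this]⟩

lemma FactorAbsorbing.left {M : Type} [Monoid M] [Finite M] (hM : FactorAbsorbing M)
    {t x a y : M} (h : x * a * y * t = t) : ∃ r, r * (a * t) = t := by
  obtain ⟨e, c, he, hc, hs⟩ := exists_idem_left h
  have hc' : e = c * x * a * y := by rw [hc]; simp only [mul_assoc]
  have := hM (c * x) a y (by rw [← hc', he])
  rw [← hc'] at this
  exact ⟨e, by rw [← hs, ← mul_assoc, ← mul_assoc, this, hs]⟩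

/-! ## The relations on finite words -/

/-- The conditions imposed by `eqvAux` on a pair of finite words, in terms of factorizations. -/
def ListEqv {A : Type} : ℕ → ZK → ℕ → List A → List A → Prop
  | 0, _, _, _, _ => True
  | _ + 1, _, 0, _, _ => True
  | n + 1, ZK.X, m + 1, u, v =>
      (∀ a, a ∈ u ↔ a ∈ v) ∧ ListEqv n ZK.Y m u v ∧
      ∀ a p q p' q', u = p ++ a :: q → a ∉ p → v = p' ++ a :: q' → a ∉ p' →
        ListEqv n ZK.Y m p p' ∧ ListEqv n ZK.X (m + 1) q q'
  | n + 1, ZK.Y, m + 1, u, v =>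
      (∀ a, a ∈ u ↔ a ∈ v) ∧ ListEqv n ZK.X m u v ∧
      ∀ a p q p' q', u = p ++ a :: q → a ∉ q → v = p' ++ a :: q' → a ∉ q' →
        ListEqv n ZK.Y (m + 1) p p' ∧ ListEqv n ZK.X m q q'
  | n + 1, ZK.WI, m + 1, u, v =>
      (∀ a, a ∈ u ↔ a ∈ v) ∧
      (∀ a p q p' q', u = p ++ a :: q → a ∉ p → v = p' ++ a :: q' → a ∉ p' →
        ListEqv n ZK.WI m p p' ∧ ListEqv n ZK.WI (m + 1) q q') ∧
      (∀ a p q p' q', u = p ++ a :: q → a ∉ q → v = p' ++ a :: q' → a ∉ q' →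
        ListEqv n ZK.WI (m + 1) p p' ∧ ListEqv n ZK.WI m q q') ∧
      ∀ a b p q r, u = p ++ b :: (q ++ a :: r) → a ∉ p ++ b :: q → b ∉ q ++ a :: r →
        ∃ p' q' r', v = p' ++ b :: (q' ++ a :: r') ∧ a ∉ p' ++ b :: q' ∧ b ∉ q' ++ a :: r' ∧
          ListEqv n ZK.WI m q q'

namespace GWord

variable {A : Type}

lemma IsFirst.unique {g : GWord A} {a : A} {p q : g.P} (hp : g.IsFirst a p)
    (hq : g.IsFirst a q) : p = q :=
  le_antisymm (hp.2 q hq.1) (hq.2 p hp.1)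

lemma IsLast.unique {g : GWord A} {a : A} {p q : g.P} (hp : g.IsLast a p)
    (hq : g.IsLast a q) : p = q :=
  le_antisymm (hq.2 p hp.1) (hp.2 q hq.1)

lemma IsFirst.XL_eq {g : GWord A} {a : A} {p : g.P} (hp : g.IsFirst a p) :
    g.XL a = g.restrict {q | q < p} := by
  have h : ∃ p, g.IsFirst a p := ⟨p, hp⟩
  rw [XL, dif_pos h, h.choose_spec.unique hp]

lemma IsFirst.XR_eq {g : GWord A} {a : A} {p : g.P} (hp : g.IsFirst a p) :
    g.XR a = g.restrict {q | p < q} := by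
  have h : ∃ p, g.IsFirst a p := ⟨p, hp⟩
  rw [XR, dif_pos h, h.choose_spec.unique hp]

lemma IsLast.YL_eq {g : GWord A} {a : A} {p : g.P} (hp : g.IsLast a p) :
    g.YL a = g.restrict {q | q < p} := by
  have h : ∃ p, g.IsLast a p := ⟨p, hp⟩
  rw [YL, dif_pos h, h.choose_spec.unique hp]

lemma IsLast.YR_eq {g : GWord A} {a : A} {p : g.P} (hp : g.IsLast a p) :
    g.YR a = g.restrict {q | p < q} := by
  have h : ∃ p, g.IsLast a p := ⟨p, hp⟩
  rw [YR, dif_pos h, h.choose_spec.unique hp]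

lemma Cab_eq {g : GWord A} {a b : A} {p q : g.P} (hp : g.IsFirst a p) (hq : g.IsLast b q)
    (hlt : q < p) : g.Cab a b = g.restrict {r | q < r ∧ r < p} := by
  have h : g.CDefined a b := ⟨p, q, hp, hq, hlt⟩
  have h1 : h.choose = p := h.choose_spec.choose_spec.1.unique hp
  have h2 : h.choose_spec.choose = q := h.choose_spec.choose_spec.2.1.unique hq
  rw [Cab, dif_pos h, h2, h1]

/-- `e` identifies the generalized word `g` with the finite word `l`. -/
def Represents (g : GWord A) (l : List A) (e : Fin l.length ≃o g.P) : Prop :=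
  ∀ i, g.w (e i) = l.get i

lemma represents_ofList (l : List A) :
    (ofList l).Represents l (OrderIso.refl (Fin l.length)) := fun _ => rfl

lemma Represents.alph_eq {g : GWord A} {l : List A} {e} (h : g.Represents l e) :
    g.alph = {a | a ∈ l} := by
  ext a
  constructor
  · rintro ⟨x, rfl⟩
    obtain ⟨i, rfl⟩ := e.surjective x
    rw [h i]
    exact List.get_mem l i
  · intro ha
    obtain ⟨i, rfl⟩ := List.get_of_mem ha
    exact ⟨e i, h i⟩

/-- A factor of a represented word is represented by the restriction to its positions. -/
lemma Represents.restrict {g : GWord A} {l p f q : List A} {e} (h : g.Represents l e)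
    (hl : l = p ++ (f ++ q)) (S : Set g.P)
    (hS : ∀ i, e i ∈ S ↔ p.length ≤ i.1 ∧ i.1 < p.length + f.length) :
    ∃ e', (g.restrict S).Represents f e' := by
  subst hl
  have hlen : ∀ i : Fin f.length, p.length + i.1 < (p ++ (f ++ q)).length := by
    intro i
    have := i.2
    simp only [List.length_append]
    omega
  let t : Fin f.length → (g.restrict S).P := fun i =>
    ⟨e ⟨p.length + i.1, hlen i⟩, (hS _).2 ⟨by simp, by simp⟩⟩
  have hmono : StrictMono t := by
    intro i j hij
    change e _ < e _
    rw [e.lt_iff_lt, Fin.mk_lt_mk]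
    exact Nat.add_lt_add_left hij _
  have hsurj : Function.Surjective t := by
    rintro ⟨x, hx⟩
    obtain ⟨j, rfl⟩ := e.surjective x
    obtain ⟨h1, h2⟩ := (hS j).1 hx
    refine ⟨⟨j.1 - p.length, by omega⟩, Subtype.ext (congrArg e (Fin.ext ?_))⟩
    simp only
    omega
  refine ⟨StrictMono.orderIsoOfSurjective t hmono hsurj, fun i => ?_⟩
  change g.w (e ⟨p.length + i.1, hlen i⟩) = _
  rw [h]
  simp [List.get_eq_getElem, List.getElem_append_right, List.getElem_append_left]

lemma Represents.isFirst {g : GWord A} {l p q : List A} {a : A} {e} (h : g.Represents l e)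
    (hl : l = p ++ a :: q) (ha : a ∉ p) (hp : p.length < l.length) :
    g.IsFirst a (e ⟨p.length, hp⟩) := by
  subst hl
  refine ⟨by rw [h]; simp, fun x hx => ?_⟩
  obtain ⟨j, rfl⟩ := e.surjective x
  rw [h] at hx
  rw [e.le_iff_le, Fin.mk_le_mk]
  by_contra! hlt
  apply ha
  rw [List.get_eq_getElem, List.getElem_append_left hlt] at hx
  rw [← hx]
  exact List.getElem_mem _

lemma Represents.isLast {g : GWord A} {l p q : List A} {a : A} {e} (h : g.Represents l e)
    (hl : l = p ++ a :: q) (ha : a ∉ q) (hp : p.length < l.length) :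
    g.IsLast a (e ⟨p.length, hp⟩) := by
  subst hl
  refine ⟨by rw [h]; simp, fun x hx => ?_⟩
  obtain ⟨j, rfl⟩ := e.surjective x
  rw [h] at hx
  rw [e.le_iff_le]
  change j.1 ≤ p.length
  by_contra! hlt
  apply ha
  rw [List.get_eq_getElem, List.getElem_append_right hlt.le, List.getElem_cons,
    dif_neg (by omega)] at hx
  rw [← hx]
  exact List.getElem_mem _

lemma Represents.left {g : GWord A} {l p q : List A} {a : A} {e} (h : g.Represents l e)
    (hl : l = p ++ a :: q) (hp : p.length < l.length) :
    ∃ e', (g.restrict {x | x < e ⟨p.length, hp⟩}).Represents p e' :=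
  h.restrict (p := []) (f := p) (q := a :: q) hl _ fun i => by
    simp [Fin.lt_def]

lemma Represents.right {g : GWord A} {l p q : List A} {a : A} {e} (h : g.Represents l e)
    (hl : l = p ++ a :: q) (hp : p.length < l.length) :
    ∃ e', (g.restrict {x | e ⟨p.length, hp⟩ < x}).Represents q e' :=
  h.restrict (p := p ++ [a]) (f := q) (q := []) (by simp [hl]) _ fun i => by
    have := i.2
    simp only [hl, List.length_append, List.length_cons] at this
    simp [Fin.lt_def]
    omega

lemma Represents.XL {g : GWord A} {l p q : List A} {a : A} {e} (h : g.Represents l e)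
    (hl : l = p ++ a :: q) (ha : a ∉ p) : ∃ e', (g.XL a).Represents p e' := by
  have hp : p.length < l.length := by simp [hl]
  rw [(h.isFirst hl ha hp).XL_eq]
  exact h.left hl hp

lemma Represents.XR {g : GWord A} {l p q : List A} {a : A} {e} (h : g.Represents l e)
    (hl : l = p ++ a :: q) (ha : a ∉ p) : ∃ e', (g.XR a).Represents q e' := by
  have hp : p.length < l.length := by simp [hl]
  rw [(h.isFirst hl ha hp).XR_eq]
  exact h.right hl hp

lemma Represents.YL {g : GWord A} {l p q : List A} {a : A} {e} (h : g.Represents l e)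
    (hl : l = p ++ a :: q) (ha : a ∉ q) : ∃ e', (g.YL a).Represents p e' := by
  have hp : p.length < l.length := by simp [hl]
  rw [(h.isLast hl ha hp).YL_eq]
  exact h.left hl hp

lemma Represents.YR {g : GWord A} {l p q : List A} {a : A} {e} (h : g.Represents l e)
    (hl : l = p ++ a :: q) (ha : a ∉ q) : ∃ e', (g.YR a).Represents q e' := by
  have hp : p.length < l.length := by simp [hl]
  rw [(h.isLast hl ha hp).YR_eq]
  exact h.right hl hp

lemma Represents.Cab {g : GWord A} {l p q r : List A} {a b : A} {e} (h : g.Represents l e)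
    (hl : l = p ++ b :: (q ++ a :: r)) (ha : a ∉ p ++ b :: q) (hb : b ∉ q ++ a :: r) :
    g.CDefined a b ∧ ∃ e', (g.Cab a b).Represents q e' := by
  have hl' : l = (p ++ b :: q) ++ a :: r := by simp [hl]
  have hp : p.length < l.length := by simp [hl]
  have hpq : (p ++ b :: q).length < l.length := by simp [hl']
  have hF := h.isFirst hl' ha hpq
  have hL := h.isLast hl hb hp
  have hlt : e ⟨p.length, hp⟩ < e ⟨(p ++ b :: q).length, hpq⟩ := by
    rw [e.lt_iff_lt, Fin.mk_lt_mk]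
    simp
  refine ⟨⟨_, _, hF, hL, hlt⟩, ?_⟩
  rw [Cab_eq hF hL hlt]
  refine h.restrict (p := p ++ [b]) (f := q) (q := a :: r) (by simp [hl]) _ fun i => ?_
  simp [Fin.lt_def]
  omega

lemma exists_last_of_mem {a : A} {l : List A} (h : a ∈ l) :
    ∃ p q, l = p ++ a :: q ∧ a ∉ q := by
  obtain ⟨p, q, hl, hp⟩ := List.eq_append_cons_of_mem (List.mem_reverse.2 h)
  refine ⟨q.reverse, p.reverse, ?_, by simpa using hp⟩
  rw [← List.reverse_reverse l, hl]
  simp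

lemma Represents.exists_of_CDefined {g : GWord A} {l : List A} {a b : A} {e}
    (h : g.Represents l e) (hab : g.CDefined a b) :
    ∃ p q r, l = p ++ b :: (q ++ a :: r) ∧ a ∉ p ++ b :: q ∧ b ∉ q ++ a :: r := by
  obtain ⟨P, Q, hP, hQ, hlt⟩ := hab
  have ha : a ∈ l := by
    change a ∈ {a | a ∈ l}
    rw [← h.alph_eq]
    exact ⟨P, hP.1⟩
  have hb : b ∈ l := by
    change b ∈ {a | a ∈ l}
    rw [← h.alph_eq]
    exact ⟨Q, hQ.1⟩
  obtain ⟨p, q, hl, hp⟩ := List.eq_append_cons_of_mem ha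
  obtain ⟨p', q', hl', hq'⟩ := exists_last_of_mem hb
  have hpl : p.length < l.length := by simp [hl]
  have hpl' : p'.length < l.length := by simp [hl']
  rw [hP.unique (h.isFirst hl hp hpl), hQ.unique (h.isLast hl' hq' hpl'), e.lt_iff_lt,
    Fin.mk_lt_mk] at hlt
  rcases List.append_eq_append_iff.1 (hl'.symm.trans hl) with ⟨t, ht, ht'⟩ | ⟨t, ht, ht'⟩
  · cases t with
    | nil => simp [ht] at hlt
    | cons c t =>
      obtain ⟨rfl, rfl⟩ : b = c ∧ q' = t ++ a :: q := by simpa using ht'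
      exact ⟨p', t, q, hl', ht ▸ hp, hq'⟩
  · simp [ht] at hlt

end GWord

lemma ListEqv.of_eqvAux {A : Type} : ∀ (n : ℕ) (k : ZK) (m : ℕ) (g h : GWord A)
    (u v : List A), (∃ e, g.Represents u e) → (∃ e, h.Represents v e) →
    eqvAux n k m g h → ListEqv n k m u v
  | 0, _, _, _, _, _, _, _, _, _ => by simp [ListEqv]
  | _ + 1, .X, 0, _, _, _, _, _, _, _ => by simp [ListEqv]
  | _ + 1, .Y, 0, _, _, _, _, _, _, _ => by simp [ListEqv]
  | _ + 1, .WI, 0, _, _, _, _, _, _, _ => by simp [ListEqv]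
  | n + 1, .X, m + 1, g, h, u, v, ⟨e, hg⟩, ⟨e', hh⟩, heq => by
    obtain ⟨h1, h2, h3⟩ := heq
    rw [hg.alph_eq, hh.alph_eq] at h1
    rw [hg.alph_eq] at h3
    refine ⟨fun a => Set.ext_iff.1 h1 a, of_eqvAux _ _ _ _ _ _ _ ⟨e, hg⟩ ⟨e', hh⟩ h2, ?_⟩
    intro a p q p' q' hu hp hv hp'
    obtain ⟨h4, h5⟩ := h3 a (by simp [hu])
    exact ⟨of_eqvAux _ _ _ _ _ _ _ (hg.XL hu hp) (hh.XL hv hp') h4,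
      of_eqvAux _ _ _ _ _ _ _ (hg.XR hu hp) (hh.XR hv hp') h5⟩
  | n + 1, .Y, m + 1, g, h, u, v, ⟨e, hg⟩, ⟨e', hh⟩, heq => by
    obtain ⟨h1, h2, h3⟩ := heq
    rw [hg.alph_eq, hh.alph_eq] at h1
    rw [hg.alph_eq] at h3
    refine ⟨fun a => Set.ext_iff.1 h1 a, of_eqvAux _ _ _ _ _ _ _ ⟨e, hg⟩ ⟨e', hh⟩ h2, ?_⟩
    intro a p q p' q' hu hp hv hp'
    obtain ⟨h4, h5⟩ := h3 a (by simp [hu])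
    exact ⟨of_eqvAux _ _ _ _ _ _ _ (hg.YL hu hp) (hh.YL hv hp') h4,
      of_eqvAux _ _ _ _ _ _ _ (hg.YR hu hp) (hh.YR hv hp') h5⟩
  | n + 1, .WI, m + 1, g, h, u, v, ⟨e, hg⟩, ⟨e', hh⟩, heq => by
    obtain ⟨h1, h2, h3⟩ := heq
    rw [hg.alph_eq, hh.alph_eq] at h1
    rw [hg.alph_eq] at h2 h3
    refine ⟨fun a => Set.ext_iff.1 h1 a, ?_, ?_, ?_⟩
    · intro a p q p' q' hu hp hv hp'
      obtain ⟨h4, h5, -, -⟩ := h2 a (by simp [hu])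
      exact ⟨of_eqvAux _ _ _ _ _ _ _ (hg.XL hu hp) (hh.XL hv hp') h4,
        of_eqvAux _ _ _ _ _ _ _ (hg.XR hu hp) (hh.XR hv hp') h5⟩
    · intro a p q p' q' hu hp hv hp'
      obtain ⟨-, -, h4, h5⟩ := h2 a (by simp [hu])
      exact ⟨of_eqvAux _ _ _ _ _ _ _ (hg.YL hu hp) (hh.YL hv hp') h4,
        of_eqvAux _ _ _ _ _ _ _ (hg.YR hu hp) (hh.YR hv hp') h5⟩
    · intro a b p q r hu ha hb
      obtain ⟨h4, h5⟩ := h3 a (by simp [hu]) b (by simp [hu])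
      obtain ⟨hC, hR⟩ := hg.Cab hu ha hb
      obtain ⟨p', q', r', hv, ha', hb'⟩ := hh.exists_of_CDefined (h4.1 hC)
      obtain ⟨hC', hR'⟩ := hh.Cab hv ha' hb'
      exact ⟨p', q', r', hv, ha', hb', of_eqvAux _ _ _ _ _ _ _ hR hR' (h5 hC hC')⟩

lemma ListEqv.of_ofList {A : Type} {n : ℕ} {k : ZK} {m : ℕ} {u v : List A}
    (h : eqvAux n k m (GWord.ofList u) (GWord.ofList v)) : ListEqv n k m u v :=
  of_eqvAux _ _ _ _ _ _ _ ⟨_, GWord.represents_ofList u⟩ ⟨_, GWord.represents_ofList v⟩ h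

/-! ## Evaluating words and locating descents -/

/-- The value of a word under the homomorphism extending `g`. -/
def wordEval {A M : Type} [Monoid M] (g : A → M) (u : List A) : M := (u.map g).prod

section wordEval

variable {A M : Type} [Monoid M] (g : A → M)

@[simp] lemma wordEval_nil : wordEval g [] = 1 := rfl

@[simp] lemma wordEval_append (u v : List A) :
    wordEval g (u ++ v) = wordEval g u * wordEval g v := by
  simp [wordEval]

@[simp] lemma wordEval_cons (a : A) (u : List A) : wordEval g (a :: u) = g a * wordEval g u := by
  simp [wordEval]

lemma map_wordEval {N : Type} [Monoid N] (f : M →* N) (u : List A) :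
    f (wordEval g u) = wordEval (f ∘ g) u := by
  simp [wordEval, map_list_prod]

variable [Finite M]

/-- Either `s` stays in its `R`-class while reading `u`, or `u` splits at the first letter that
leaves it, and this letter is new. -/
lemma exists_right_descent (hM : FactorAbsorbing M) (s : M) (u : List A)
    (h : ¬ ∃ r, s * wordEval g u * r = s) :
    ∃ p a q, u = p ++ a :: q ∧ a ∉ p ∧ (∃ r, s * wordEval g p * r = s) ∧
      ¬ ∃ r, s * (wordEval g p * g a) * r = s := by
  induction u using List.reverseRecOn with
  | nil => exact absurd ⟨1, by simp⟩ h
  | append_singleton w c ih =>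
    by_cases hw : ∃ r, s * wordEval g w * r = s
    · refine ⟨w, c, [], rfl, fun hc => h ?_, hw, by simpa using h⟩
      obtain ⟨x, y, rfl⟩ := List.append_of_mem hc
      obtain ⟨r, hr⟩ := hw
      obtain ⟨r', hr'⟩ := hM.right (s := s * wordEval g (x ++ c :: y))
        (x := r * wordEval g x) (a := g c) (y := wordEval g y) (by
          have : r * wordEval g x * g c * wordEval g y = r * wordEval g (x ++ c :: y) := by
            simp [mul_assoc]
          rw [this, ← mul_assoc, hr])
      refine ⟨r' * r, ?_⟩
      rw [wordEval_append _ _ [c], ← mul_assoc, ← mul_assoc]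
      simp only [wordEval_cons, wordEval_nil, mul_one]
      rw [wordEval_append] at hr hr'
      rw [wordEval_cons] at hr hr'
      rw [wordEval_append, wordEval_cons, hr', hr]
    · obtain ⟨p, a, q, rfl, ha, hp, hd⟩ := ih hw
      exact ⟨p, a, q ++ [c], by simp, ha, hp, hd⟩

lemma exists_left_descent (hM : FactorAbsorbing M) (t : M) (u : List A)
    (h : ¬ ∃ r, r * (wordEval g u * t) = t) :
    ∃ p a q, u = p ++ a :: q ∧ a ∉ q ∧ (∃ r, r * (wordEval g q * t) = t) ∧
      ¬ ∃ r, r * (g a * wordEval g q * t) = t := by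
  induction u with
  | nil => exact absurd ⟨1, by simp⟩ h
  | cons c w ih =>
    by_cases hw : ∃ r, r * (wordEval g w * t) = t
    · refine ⟨[], c, w, rfl, fun hc => h ?_, hw, by simpa using h⟩
      obtain ⟨x, y, hxy⟩ := List.append_of_mem hc
      obtain ⟨r, hr⟩ := hw
      obtain ⟨r', hr'⟩ := hM.left (t := wordEval g w * t)
        (x := wordEval g x) (a := g c) (y := wordEval g y * r) (by
          have : wordEval g x * g c * (wordEval g y * r) = wordEval g w * r := by
            simp [hxy, mul_assoc]
          rw [this, mul_assoc, hr])
      exact ⟨r * r', by rw [wordEval_cons, mul_assoc, mul_assoc, hr', hr]⟩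
    · obtain ⟨p, a, q, rfl, ha, hp, hd⟩ := ih hw
      exact ⟨c :: p, a, q, by simp, ha, hp, hd⟩

end wordEval

/-- The size of the right ideal generated by `s`. -/
noncomputable def rHeight {M : Type} [Monoid M] (s : M) : ℕ := (Set.range (s * ·)).ncard

/-- The size of the left ideal generated by `t`. -/
noncomputable def lHeight {M : Type} [Monoid M] (t : M) : ℕ := (Set.range (· * t)).ncard

lemma rHeight_pos {M : Type} [Monoid M] [Finite M] (s : M) : 0 < rHeight s :=
  (Set.ncard_pos (Set.toFinite _)).2 ⟨s * 1, 1, rfl⟩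

lemma lHeight_pos {M : Type} [Monoid M] [Finite M] (t : M) : 0 < lHeight t :=
  (Set.ncard_pos (Set.toFinite _)).2 ⟨1 * t, 1, rfl⟩

lemma rHeight_lt {M : Type} [Monoid M] [Finite M] {s x : M} (h : ¬ ∃ r, s * x * r = s) :
    rHeight (s * x) < rHeight s := by
  refine Set.ncard_lt_ncard ⟨?_, fun hs => h ?_⟩ (Set.toFinite _)
  · rintro _ ⟨z, rfl⟩
    exact ⟨x * z, by simp only [mul_assoc]⟩
  · exact hs ⟨1, mul_one s⟩

lemma lHeight_lt {M : Type} [Monoid M] [Finite M] {t x : M} (h : ¬ ∃ r, r * (x * t) = t) :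
    lHeight (x * t) < lHeight t := by
  refine Set.ncard_lt_ncard ⟨?_, fun hs => h ?_⟩ (Set.toFinite _)
  · rintro _ ⟨z, rfl⟩
    exact ⟨z * x, by simp only [mul_assoc]⟩
  · exact hs ⟨1, one_mul t⟩

lemma rHeight_le_card {M : Type} [Monoid M] [Finite M] (s : M) : rHeight s ≤ Nat.card M :=
  Set.ncard_le_card _

lemma lHeight_le_card {M : Type} [Monoid M] [Finite M] (t : M) : lHeight t ≤ Nat.card M :=
  Set.ncard_le_card _

lemma append_cons_inj_of_notMem_left {A : Type} {p q p' q' : List A} {a : A}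
    (h : p ++ a :: q = p' ++ a :: q') (hp : a ∉ p) (hp' : a ∉ p') : p = p' ∧ q = q' := by
  rcases List.append_eq_append_iff.1 h with ⟨t, rfl, ht⟩ | ⟨t, rfl, ht⟩ <;> cases t <;> simp_all

lemma append_cons_inj_of_notMem_right {A : Type} {p q p' q' : List A} {a : A}
    (h : p ++ a :: q = p' ++ a :: q') (hq : a ∉ q) (hq' : a ∉ q') : p = p' ∧ q = q' := by
  rcases List.append_eq_append_iff.1 h with ⟨t, rfl, ht⟩ | ⟨t, rfl, ht⟩ <;> cases t <;> simp_all

/-- Relative order of two marked positions of a word. -/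
lemma append_cons_eq_append_cons {A : Type} {p q p' q' : List A} {a b : A}
    (h : p ++ a :: q = p' ++ b :: q') :
    (∃ x, p' = p ++ a :: x ∧ q = x ++ b :: q') ∨ (p = p' ∧ a = b ∧ q = q') ∨
      ∃ x, p = p' ++ b :: x ∧ q' = x ++ a :: q := by
  rcases List.append_eq_append_iff.1 h with ⟨t, rfl, ht⟩ | ⟨t, rfl, ht⟩ <;> cases t <;> simp_all

lemma ListEqv.mem_iff {A : Type} {n : ℕ} {k : ZK} {m : ℕ} {u v : List A}
    (h : ListEqv (n + 1) k (m + 1) u v) (a : A) : a ∈ u ↔ a ∈ v := by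
  cases k <;> exact h.1 a

lemma ListEqv.WI_of_succ {A : Type} : ∀ (n m : ℕ) (u v : List A),
    ListEqv n .WI (m + 1) u v → ListEqv n .WI m u v
  | 0, _, _, _, _ => by simp [ListEqv]
  | _ + 1, 0, _, _, _ => by simp [ListEqv]
  | n + 1, m + 1, u, v, ⟨h1, h2, h3, h4⟩ => by
    refine ⟨h1, ?_, ?_, ?_⟩
    · intro a p q p' q' hu hp hv hp'
      obtain ⟨h5, h6⟩ := h2 a p q p' q' hu hp hv hp'
      exact ⟨WI_of_succ _ _ _ _ h5, WI_of_succ _ _ _ _ h6⟩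
    · intro a p q p' q' hu hp hv hp'
      obtain ⟨h5, h6⟩ := h3 a p q p' q' hu hp hv hp'
      exact ⟨WI_of_succ _ _ _ _ h5, WI_of_succ _ _ _ _ h6⟩
    · intro a b p q r hu ha hb
      obtain ⟨p', q', r', hv, ha', hb', h⟩ := h4 a b p q r hu ha hb
      exact ⟨p', q', r', hv, ha', hb', WI_of_succ _ _ _ _ h⟩

/-! ## The two-sided induction -/

section WI

variable {A M : Type} [Monoid M] [Finite M] (g : A → M) (m n₀ : ℕ)

/-- Words related at level `m` may be exchanged between contexts whose `R`- and `L`-classes they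
preserve. -/
def LocallyExchangeable : Prop :=
  ∀ n, n₀ ≤ n → ∀ u v : List A, ListEqv n .WI m u v → ∀ s t : M,
    (∃ r, s * wordEval g u * r = s) → (∃ r, r * (wordEval g v * t) = t) →
      s * wordEval g u * t = s * wordEval g v * t

theorem LocallyExchangeable.eval_eq (hM : FactorAbsorbing M)
    (hloc : LocallyExchangeable g m n₀) (n : ℕ) : ∀ (s t : M) (u v : List A),
    n₀ + rHeight s + lHeight t ≤ n → ListEqv n .WI (m + 1) u v →
      s * wordEval g u * t = s * wordEval g v * t := by
  induction n using Nat.strong_induction_on with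
  | _ n ih =>
  intro s t u v hn huv
  have hs := rHeight_pos s
  have ht := lHeight_pos t
  obtain ⟨n, rfl⟩ : ∃ k, n = k + 2 := ⟨n - 2, by omega⟩
  obtain ⟨hmem, hX, hY, hC⟩ := id huv
  by_cases hu : ∃ r, s * wordEval g u * r = s
  · by_cases hv : ∃ r, r * (wordEval g v * t) = t
    · exact hloc (n + 2) (by omega) u v (huv.WI_of_succ _ _) s t hu hv
    · obtain ⟨v₀, b, v₁, rfl, hb, hv₁, hdesc⟩ := exists_left_descent g hM t v hv
      obtain ⟨u₀, u₁, rfl, hb'⟩ := GWord.exists_last_of_mem ((hmem b).2 (by simp))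
      obtain ⟨h0, h1⟩ := hY b _ _ _ _ rfl hb' rfl hb
      have hlt := lHeight_lt hdesc
      have e0 := ih (n + 1) (by omega) s (g b * wordEval g v₁ * t) u₀ v₀ (by omega) h0
      have e1 := hloc (n + 1) (by omega) u₁ v₁ h1 (s * wordEval g u₀ * g b) t ?_ hv₁
      · simp only [wordEval_append, wordEval_cons, mul_assoc] at e0 e1 ⊢
        rw [e1, e0]
      · obtain ⟨r, hr⟩ := hu
        refine ⟨r * wordEval g u₀ * g b, ?_⟩
        conv_rhs => rw [← hr]
        simp only [wordEval_append, wordEval_cons, mul_assoc]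
  · obtain ⟨u₀, a, u₁, rfl, ha, hu₀, hdesc⟩ := exists_right_descent g hM s u hu
    obtain ⟨v₀, v₁, rfl, ha'⟩ := List.eq_append_cons_of_mem ((hmem a).1 (by simp))
    obtain ⟨h0, h1⟩ := hX a _ _ _ _ rfl ha rfl ha'
    have hlt := rHeight_lt hdesc
    have e1 := ih (n + 1) (by omega) (s * (wordEval g u₀ * g a)) t u₁ v₁ (by omega) h1
    by_cases hv : ∃ r, r * (wordEval g (v₀ ++ a :: v₁) * t) = t
    · have e0 := hloc (n + 1) (by omega) u₀ v₀ h0 s (g a * wordEval g v₁ * t) hu₀ ?_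
      · simp only [wordEval_append, wordEval_cons, mul_assoc] at e0 e1 ⊢
        rw [e1, e0]
      · obtain ⟨r, hr⟩ := hv
        refine ⟨g a * wordEval g v₁ * r, ?_⟩
        conv_rhs => rw [← hr]
        simp only [wordEval_append, wordEval_cons, mul_assoc]
    · obtain ⟨v₀', b, v₁', hv', hb, hv₁, hdesc'⟩ := exists_left_descent g hM t _ hv
      have hlt' := lHeight_lt hdesc'
      obtain ⟨u₀', u₁', hu', hb'⟩ := GWord.exists_last_of_mem ((hmem b).2 (by simp [hv']))
      obtain ⟨h0', h1'⟩ := hY b _ _ _ _ hu' hb' hv' hb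
      have e0 := ih (n + 1) (by omega) s (g b * wordEval g v₁' * t) u₀' v₀' (by omega) h0'
      rcases append_cons_eq_append_cons hu' with ⟨x, rfl, rfl⟩ | ⟨rfl, rfl, rfl⟩ | ⟨x, rfl, rfl⟩
      · -- the first `a` precedes the last `b`
        obtain ⟨x', y', rfl, hy'⟩ :=
          GWord.exists_last_of_mem ((h1.mem_iff b).1 (by simp))
        obtain ⟨hx, -⟩ := h1.2.2.1 b _ _ _ _ rfl hb' rfl hy'
        obtain ⟨rfl, rfl⟩ := append_cons_inj_of_notMem_right
          (p := v₀ ++ a :: x') (by rw [← hv']; simp) hy' hb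
        have ex := ih n (by omega) (s * (wordEval g u₀ * g a)) (g b * wordEval g y' * t) x x'
          (by omega) hx
        simp only [wordEval_append, wordEval_cons, mul_assoc] at e0 e1 ex ⊢
        rw [e1, ← e0, ex]
      · -- the first `a` is the last `b`
        obtain ⟨rfl, rfl⟩ := append_cons_inj_of_notMem_right hv' (by rwa [← h1.mem_iff]) hb
        simp only [wordEval_append, wordEval_cons, mul_assoc] at e0 e1 ⊢
        rw [e1, e0]
      · -- the last `b` precedes the first `a`
        obtain ⟨p', x', r', hv'', ha'', hb'', hx⟩ := hC a b u₀' x u₁ (by simp) ha hb'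
        obtain ⟨rfl, rfl⟩ := append_cons_inj_of_notMem_left
          (p' := p' ++ b :: x') (q' := r') (by rw [hv'']; simp) ha' ha''
        obtain ⟨rfl, rfl⟩ := append_cons_inj_of_notMem_right (hv'.symm.trans hv'') hb hb''
        have ex := hloc (n + 1) (by omega) x x' hx (s * wordEval g u₀' * g b)
          (g a * wordEval g v₁ * t) ?_ ?_
        · simp only [wordEval_append, wordEval_cons, mul_assoc] at e0 e1 ex ⊢
          rw [e1, ex, e0]
        · obtain ⟨r, hr⟩ := hu₀
          refine ⟨r * wordEval g u₀' * g b, ?_⟩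
          conv_rhs => rw [← hr]
          simp only [wordEval_append, wordEval_cons, mul_assoc]
        · obtain ⟨r, hr⟩ := hv₁
          refine ⟨g a * wordEval g v₁ * r, ?_⟩
          conv_rhs => rw [← hr]
          simp only [wordEval_append, wordEval_cons, mul_assoc]

theorem LocallyExchangeable.exists_bound (hM : FactorAbsorbing M)
    (hloc : LocallyExchangeable g m n₀) : ∃ N, ∀ n, N ≤ n → ∀ u v : List A,
    ListEqv n .WI (m + 1) u v → wordEval g u = wordEval g v := by
  refine ⟨n₀ + Nat.card M + Nat.card M, fun n hn u v huv => ?_⟩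
  have h1 := rHeight_le_card (1 : M)
  have h2 := lHeight_le_card (1 : M)
  simpa using hloc.eval_eq g m n₀ hM n 1 1 u v (by omega) huv

end WI

/-- Triviality of `R` and `L` makes the lowest level exchangeable. -/
lemma LocallyExchangeable.of_trivial {A M : Type} [Monoid M] (g : A → M)
    (hR : ∀ s x r : M, s * x * r = s → s * x = s)
    (hL : ∀ t x r : M, r * (x * t) = t → x * t = t) : LocallyExchangeable g 0 0 := by
  rintro n - u v - s t ⟨r, hr⟩ ⟨r', hr'⟩
  rw [hR _ _ _ hr, mul_assoc, hL _ _ _ hr']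

/-! ## Level one: subwords and `J`-trivial monoids -/

lemma cons_sublist_append_cons_iff {A : Type} {a : A} {w p q : List A} (hp : a ∉ p) :
    (a :: w).Sublist (p ++ a :: q) ↔ w.Sublist q := by
  induction p with
  | nil => exact List.cons_sublist_cons
  | cons b p ih =>
    obtain ⟨hab, hp⟩ : a ≠ b ∧ a ∉ p := by simpa using hp
    rw [List.cons_append, List.cons_sublist_cons', ih hp]
    simp [hab]

lemma append_singleton_sublist_iff {A : Type} {a : A} {w p q : List A} (hq : a ∉ q) :
    (w ++ [a]).Sublist (p ++ a :: q) ↔ w.Sublist p := by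
  rw [← List.reverse_sublist]
  simp only [List.reverse_append, List.reverse_cons, List.reverse_nil, List.nil_append,
    List.singleton_append, List.append_assoc]
  rw [cons_sublist_append_cons_iff (by simpa using hq), List.reverse_sublist]

/-- `u` and `v` have the same subwords of length at most `n`. -/
def SameSubwords {A : Type} (n : ℕ) (u v : List A) : Prop :=
  ∀ w : List A, w.length ≤ n → (w.Sublist u ↔ w.Sublist v)

lemma SameSubwords.of_listEqv_X {A : Type} : ∀ (n : ℕ) (u v : List A),
    ListEqv n .X 1 u v → SameSubwords n u v
  | _, _, _, _, [], _ => by simp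
  | n + 1, u, v, ⟨hmem, _, h⟩, a :: w, hw => by
    by_cases ha : a ∈ u
    · obtain ⟨p, q, rfl, hp⟩ := List.eq_append_cons_of_mem ha
      obtain ⟨p', q', rfl, hp'⟩ := List.eq_append_cons_of_mem ((hmem a).1 ha)
      rw [cons_sublist_append_cons_iff hp, cons_sublist_append_cons_iff hp']
      exact of_listEqv_X n _ _ (h a _ _ _ _ rfl hp rfl hp').2 w (by simpa using hw)
    · exact ⟨fun hs => absurd (hs.subset (by simp)) ha,
        fun hs => absurd ((hmem a).2 (hs.subset (by simp))) ha⟩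

lemma SameSubwords.of_listEqv_Y {A : Type} (n : ℕ) : ∀ u v : List A,
    ListEqv n .Y 1 u v → SameSubwords n u v := by
  induction n with
  | zero =>
    intro u v _ w hw
    obtain rfl := List.length_eq_zero_iff.1 (Nat.le_zero.1 hw)
    simp
  | succ n ih =>
    rintro u v ⟨hmem, -, h⟩ w hw
    rcases List.eq_nil_or_concat' w with rfl | ⟨w, a, rfl⟩
    · simp
    · by_cases ha : a ∈ u
      · obtain ⟨p, q, rfl, hp⟩ := GWord.exists_last_of_mem ha
        obtain ⟨p', q', rfl, hp'⟩ := GWord.exists_last_of_mem ((hmem a).1 ha)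
        rw [append_singleton_sublist_iff hp, append_singleton_sublist_iff hp']
        exact ih _ _ (h a _ _ _ _ rfl hp rfl hp').1 w (by simpa using hw)
      · exact ⟨fun hs => absurd (hs.subset (by simp)) ha,
          fun hs => absurd ((hmem a).2 (hs.subset (by simp))) ha⟩

lemma SameSubwords.mem_iff {A : Type} {n : ℕ} {u v : List A} (h : SameSubwords (n + 1) u v)
    (a : A) : a ∈ u ↔ a ∈ v := by
  simpa using h [a] (by simp)

lemma ListEqv.zero_level {A : Type} (n : ℕ) (k : ZK) (u v : List A) : ListEqv n k 0 u v := by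
  cases n <;> simp [ListEqv]

lemma ListEqv.WI_of_sameSubwords {A : Type} : ∀ (n : ℕ) (u v : List A),
    SameSubwords (2 * n) u v → ListEqv n .WI 1 u v
  | 0, _, _, _ => trivial
  | n + 1, u, v, h => by
    have hmem := SameSubwords.mem_iff (n := 2 * n + 1) h
    refine ⟨hmem, ?_, ?_, ?_⟩
    · rintro a p q p' q' rfl hp rfl hp'
      refine ⟨zero_level _ _ _ _, WI_of_sameSubwords n _ _ fun w hw => ?_⟩
      rw [← cons_sublist_append_cons_iff hp, h _ (by simp; omega),
        cons_sublist_append_cons_iff hp']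
    · rintro a p q p' q' rfl hp rfl hp'
      refine ⟨WI_of_sameSubwords n _ _ fun w hw => ?_, zero_level _ _ _ _⟩
      rw [← append_singleton_sublist_iff hp, h _ (by simp; omega),
        append_singleton_sublist_iff hp']
    · rintro a b p q r rfl ha hb
      have hab : a ≠ b := by rintro rfl; simp at ha
      have hmem' := hmem b
      have hnot := h [a, b] (by simp)
      obtain ⟨s, r', rfl, hs⟩ := List.eq_append_cons_of_mem ((hmem a).1 (by simp))
      rw [show p ++ b :: (q ++ a :: r) = (p ++ b :: q) ++ a :: r by simp,
        cons_sublist_append_cons_iff ha, cons_sublist_append_cons_iff hs,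
        List.singleton_sublist, List.singleton_sublist] at hnot
      have hr' : b ∉ r' := fun hb' => hb (by simp [hnot.2 hb'])
      obtain ⟨p', q', rfl, hq'⟩ := GWord.exists_last_of_mem
        (show b ∈ s by simpa [hab.symm, hr'] using hmem')
      exact ⟨p', q', r', by simp, hs, by simp [hq', hr', hab.symm], zero_level _ _ _ _⟩

lemma SameSubwords.exists_bound {A M : Type} [Monoid M] [Finite M] (hM : IsJTrivial M)
    (g : A → M) : ∃ N, ∀ n, N ≤ n → ∀ u v : List A, SameSubwords n u v →
      wordEval g u = wordEval g v := by
  obtain ⟨N, hN⟩ := LocallyExchangeable.exists_bound g 0 0 (.of_jTrivial hM)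
    (.of_trivial g (fun _ _ _ => hM.mul_right_eq) (fun _ _ _ => hM.mul_left_eq))
  exact ⟨2 * N, fun n hn u v h => hN N le_rfl u v
    (.WI_of_sameSubwords _ _ _ fun w hw => h w (hw.trans hn))⟩

/-! ## The one-sided induction -/

lemma mul_wordEval_eq_of_X {A M : Type} [Monoid M] [Finite M] (hM : FactorAbsorbing M)
    (g : A → M) (m n₀ : ℕ)
    (h₀ : ∀ n, n₀ ≤ n → ∀ u v : List A, ListEqv n .Y m u v →
      simK (wordEval g u) (wordEval g v)) (n : ℕ) :
    ∀ (s : M) (u v : List A), n₀ + rHeight s ≤ n → ListEqv n .X (m + 1) u v →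
      s * wordEval g u = s * wordEval g v := by
  induction n with
  | zero =>
    intro s _ _ hn
    have := rHeight_pos s
    omega
  | succ n ih =>
    intro s u v hn huv
    have hs := rHeight_pos s
    by_cases hu : ∃ r, s * wordEval g u * r = s
    · obtain ⟨r, hr⟩ := hu
      exact (h₀ n (by omega) u v huv.2.1).mul_eq hr
    · obtain ⟨u₀, a, u₁, rfl, ha, ⟨r, hr⟩, hdesc⟩ := exists_right_descent g hM s u hu
      obtain ⟨v₀, v₁, rfl, ha'⟩ := List.eq_append_cons_of_mem ((huv.mem_iff a).1 (by simp))
      obtain ⟨h0, h1⟩ := huv.2.2 a _ _ _ _ rfl ha rfl ha'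
      have hlt := rHeight_lt hdesc
      have e0 := (h₀ n (by omega) u₀ v₀ h0).mul_eq hr
      have e1 := ih (s * (wordEval g u₀ * g a)) u₁ v₁ (by omega) h1
      simp only [wordEval_append, wordEval_cons, ← mul_assoc] at e0 e1 ⊢
      rw [e1, e0]

lemma wordEval_mul_eq_of_Y {A M : Type} [Monoid M] [Finite M] (hM : FactorAbsorbing M)
    (g : A → M) (m n₀ : ℕ)
    (h₀ : ∀ n, n₀ ≤ n → ∀ u v : List A, ListEqv n .X m u v →
      simD (wordEval g u) (wordEval g v)) (n : ℕ) :
    ∀ (t : M) (u v : List A), n₀ + lHeight t ≤ n → ListEqv n .Y (m + 1) u v →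
      wordEval g u * t = wordEval g v * t := by
  induction n with
  | zero =>
    intro t _ _ hn
    have := lHeight_pos t
    omega
  | succ n ih =>
    intro t u v hn huv
    have ht := lHeight_pos t
    by_cases hu : ∃ r, r * (wordEval g u * t) = t
    · obtain ⟨r, hr⟩ := hu
      exact (h₀ n (by omega) u v huv.2.1).mul_eq hr
    · obtain ⟨u₀, a, u₁, rfl, ha, ⟨r, hr⟩, hdesc⟩ := exists_left_descent g hM t u hu
      obtain ⟨v₀, v₁, rfl, ha'⟩ := GWord.exists_last_of_mem ((huv.mem_iff a).1 (by simp))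
      obtain ⟨h0, h1⟩ := huv.2.2 a _ _ _ _ rfl ha rfl ha'
      have hlt := lHeight_lt hdesc
      have e0 := (h₀ n (by omega) u₁ v₁ h1).mul_eq hr
      have e1 := ih (g a * wordEval g u₁ * t) u₀ v₀ (by omega) h0
      simp only [wordEval_append, wordEval_cons, mul_assoc] at e0 e1 ⊢
      rw [e1, e0]

/-- The kind of relation that governs the levels `R_m` and `L_m`. -/
def sideKind : Bool → ZK
  | true => .X
  | false => .Y

theorem InRLAux.exists_bound : ∀ (k : ℕ) (b : Bool) (A M : Type) (i : Monoid M) [Finite M],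
    InRLAux k b M i → ∀ g : A → M, ∃ N, ∀ n, N ≤ n → ∀ u v : List A,
      ListEqv n (sideKind b) (k + 1) u v → wordEval g u = wordEval g v
  | 0, true, _, _, _, _, h, g => by
    obtain ⟨N, hN⟩ := SameSubwords.exists_bound h g
    exact ⟨N, fun n hn u v huv => hN n hn u v (.of_listEqv_X _ _ _ huv)⟩
  | 0, false, _, _, _, _, h, g => by
    obtain ⟨N, hN⟩ := SameSubwords.exists_bound h g
    exact ⟨N, fun n hn u v huv => hN n hn u v (.of_listEqv_Y _ _ _ huv)⟩
  | k + 1, true, A, M, i, _, h, g => by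
    obtain ⟨N, hN⟩ := exists_bound k false A _ _ h ((KCon M).mk' ∘ g)
    refine ⟨N + Nat.card M, fun n hn u v huv => ?_⟩
    have := rHeight_le_card (1 : M)
    simpa using mul_wordEval_eq_of_X (.of_InRLAux _ _ _ i h) g (k + 1) N
      (fun n hn u v huv => KCon_iff.1 ((Con.eq _).1 (by
        have := hN n hn u v huv
        rwa [← map_wordEval, ← map_wordEval] at this))) n 1 u v (by omega) huv
  | k + 1, false, A, M, i, _, h, g => by
    obtain ⟨N, hN⟩ := exists_bound k true A _ _ h ((DCon M).mk' ∘ g)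
    refine ⟨N + Nat.card M, fun n hn u v huv => ?_⟩
    have := lHeight_le_card (1 : M)
    simpa using wordEval_mul_eq_of_Y (.of_InRLAux _ _ _ i h) g (k + 1) N
      (fun n hn u v huv => DCon_iff.1 ((Con.eq _).1 (by
        have := hN n hn u v huv
        rwa [← map_wordEval, ← map_wordEval] at this))) n 1 u v (by omega) huv

/-! ## The intersection of `R_{m+1}` and `L_{m+1}` -/

lemma mul_right_eq_of_KCon {M : Type} [Monoid M] [Finite M]
    (hM : IsJTrivial (KCon M).Quotient) {s x r : M} (h : s * x * r = s) : s * x = s := by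
  obtain ⟨e, c, he, hc, hs⟩ := exists_idem_right (w := x * r) (by rw [← mul_assoc, h])
  have h1 : ((e * x : M) : (KCon M).Quotient) = (e : M) := by
    refine hM.mul_right_eq (s := (e : (KCon M).Quotient)) (x := x) (r := ((r * c : M) : (KCon M).Quotient)) ?_
    rw [← Con.coe_mul, ← Con.coe_mul, mul_assoc, ← mul_assoc x, ← hc, he]
  have h2 := (simK_iff _ _).1 (KCon_iff.1 ((Con.eq _).1 h1)) e he
    (.inr ⟨1, by rw [he, mul_one]⟩)
  rw [← mul_assoc, he] at h2
  rw [← hs, mul_assoc, h2]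

lemma mul_left_eq_of_DCon {M : Type} [Monoid M] [Finite M]
    (hM : IsJTrivial (DCon M).Quotient) {t x r : M} (h : r * (x * t) = t) : x * t = t := by
  obtain ⟨e, c, he, hc, ht⟩ := exists_idem_left (w := r * x) (by rw [mul_assoc, h])
  have h1 : ((x * e : M) : (DCon M).Quotient) = (e : M) := by
    refine hM.mul_left_eq (t := (e : (DCon M).Quotient)) (x := x) (r := ((c * r : M) : (DCon M).Quotient)) ?_
    rw [← Con.coe_mul, ← Con.coe_mul, ← mul_assoc, mul_assoc c, ← hc, he]
  have h2 := (simD_iff _ _).1 (DCon_iff.1 ((Con.eq _).1 h1)) e he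
    (.inr ⟨1, by rw [he, one_mul]⟩)
  rw [mul_assoc, he] at h2
  rw [← ht, ← mul_assoc, h2]

/-- The join of the congruences `∼_K` and `∼_D`. -/
def KDCon (M : Type) [Monoid M] [Finite M] : Con M :=
  stableCon (fun x y => simK x y ∨ simD x y)
    (fun _ _ z h => h.imp (fun h => simK_mul_left h z) (fun h => simD_mul_left h z))
    (fun _ _ z h => h.imp (fun h => simK_mul_right h z) (fun h => simD_mul_right h z))

lemma FactorAbsorbing.mul_mul_eq {M : Type} [Monoid M] (hM : FactorAbsorbing M)
    {e x : M} (he : e * e = e) (h : ∃ p q, p * x * q = e) : e * x * e = e := by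
  obtain ⟨p, q, rfl⟩ := h
  exact hM p x q he

/-- Elements identified by `KDCon` lie above the same idempotents and act alike between them. -/
lemma FactorAbsorbing.of_KDCon {M : Type} [Monoid M] [Finite M] (hM : FactorAbsorbing M)
    {x y : M} (h : KDCon M x y) :
    (∀ e : M, e * e = e → ((∃ p q, p * x * q = e) ↔ ∃ p q, p * y * q = e)) ∧
      ∀ e f : M, e * e = e → f * f = f → (∃ p q, p * x * q = e) → (∃ p q, p * x * q = f) →
        e * x * f = e * y * f := by
  have key : ∀ x y : M, simK x y ∨ simD x y → ∀ e : M, e * e = e → (∃ p q, p * x * q = e) →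
      (e * x = e * y ∨ x * e = y * e) ∧ ∃ p q, p * y * q = e := by
    intro x y h e he hx
    have hexe := hM.mul_mul_eq he hx
    rcases h with h | h
    · have h1 := (simK_iff _ _).1 h e he (.inl ⟨e, hexe⟩)
      exact ⟨.inl h1, e, e, by rw [← h1, hexe]⟩
    · have h1 := (simD_iff _ _).1 h e he (.inl ⟨e, by rw [← mul_assoc, hexe]⟩)
      exact ⟨.inr h1, e, e, by rw [mul_assoc, ← h1, ← mul_assoc, hexe]⟩
  change Relation.EqvGen _ x y at h
  induction h with
  | rel x y h =>
    refine ⟨fun e he => ⟨fun hx => (key x y h e he hx).2,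
      fun hy => (key y x (h.imp simK_symm simD_symm) e he hy).2⟩, fun e f he hf hx hx' => ?_⟩
    have h1 := hM.mul_mul_eq he hx
    have h2 := hM.mul_mul_eq hf hx'
    rcases h with h | h
    · rw [(simK_iff _ _).1 h e he (.inl ⟨e, h1⟩)]
    · rw [mul_assoc, (simD_iff _ _).1 h f hf (.inl ⟨f, by rw [← mul_assoc, h2]⟩), mul_assoc]
  | refl => simp
  | symm x y _ ih =>
    exact ⟨fun e he => (ih.1 e he).symm, fun e f he hf hx hx' =>
      (ih.2 e f he hf ((ih.1 e he).2 hx) ((ih.1 f hf).2 hx')).symm⟩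
  | trans x y z _ _ ih ih' =>
    exact ⟨fun e he => (ih.1 e he).trans (ih'.1 e he), fun e f he hf hx hx' =>
      (ih.2 e f he hf hx hx').trans (ih'.2 e f he hf ((ih.1 e he).1 hx) ((ih.1 f hf).1 hx'))⟩

lemma FactorAbsorbing.mul_mul_eq_of_KDCon {M : Type} [Monoid M] [Finite M]
    (hM : FactorAbsorbing M) {x y s t r r' : M} (h : KDCon M x y) (hs : s * x * r = s)
    (ht : r' * (y * t) = t) : s * x * t = s * y * t := by
  obtain ⟨e, c, he, hc, hse⟩ := exists_idem_right (w := x * r) (by rw [← mul_assoc, hs])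
  obtain ⟨f, d, hf, hd, hft⟩ := exists_idem_left (w := r' * y) (by rw [mul_assoc, ht])
  obtain ⟨h1, h2⟩ := hM.of_KDCon h
  have := h2 e f he hf ⟨1, r * c, by rw [hc]; simp only [one_mul, mul_assoc]⟩
    ((h1 f hf).2 ⟨d * r', 1, by rw [hd]; simp only [mul_one, mul_assoc]⟩)
  calc s * x * t = s * (e * x * f) * t := by
        conv_lhs => rw [← hse, ← hft]
        simp only [mul_assoc]
    _ = s * y * t := by
        rw [this]
        conv_rhs => rw [← hse, ← hft]
        simp only [mul_assoc]

theorem InRLAux.exists_bound_WI : ∀ (k : ℕ) (A M : Type) (i : Monoid M) [Finite M],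
    InRLAux (k + 1) true M i → InRLAux (k + 1) false M i → ∀ g : A → M, ∃ N, ∀ n, N ≤ n →
      ∀ u v : List A, ListEqv n .WI (k + 1) u v → wordEval g u = wordEval g v
  | 0, _, _, i, _, hR, hL, g =>
    LocallyExchangeable.exists_bound g 0 0 (.of_InRLAux _ _ _ i hR)
      (.of_trivial g (fun _ _ _ => mul_right_eq_of_KCon hR)
        (fun _ _ _ => mul_left_eq_of_DCon hL))
  | k + 1, A, M, i, _, hR, hL, g => by
    have hM : FactorAbsorbing M := .of_InRLAux _ _ _ i hR
    obtain ⟨fK, hfK⟩ := exists_quotient_map (.id M) Function.surjective_id (KCon M) (KDCon M)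
      fun x y h => Relation.EqvGen.rel _ _ (.inl (KCon_iff.1 h))
    obtain ⟨fD, hfD⟩ := exists_quotient_map (.id M) Function.surjective_id (DCon M) (KDCon M)
      fun x y h => Relation.EqvGen.rel _ _ (.inr (DCon_iff.1 h))
    obtain ⟨N, hN⟩ := exists_bound_WI k A (KDCon M).Quotient inferInstance
      (InRLAux_map _ _ _ _ _ _ fD hfD hL) (InRLAux_map _ _ _ _ _ _ fK hfK hR)
      ((KDCon M).mk' ∘ g)
    refine LocallyExchangeable.exists_bound g (k + 1) N hM ?_
    rintro n hn u v huv s t ⟨r, hr⟩ ⟨r', hr'⟩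
    refine hM.mul_mul_eq_of_KDCon ((Con.eq _).1 ?_) hr hr'
    have := hN n hn u v huv
    rwa [← map_wordEval, ← map_wordEval] at this

/-! ## Divisors of products and the main theorem -/

theorem InJoin.exists_bound {A M : Type} [Monoid M] {k : ℕ} (h : InJoin (k + 1) M) (g : A → M) :
    ∃ N, ∀ n, N ≤ n → ∀ u v : List A, ListEqv n .X (k + 1) u v → ListEqv n .Y (k + 1) u v →
      wordEval g u = wordEval g v := by
  obtain ⟨M₁, M₂, i₁, i₂, _, _, h₁, h₂, S, f, hf⟩ := h
  choose lift hlift using hf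
  obtain ⟨N₁, hN₁⟩ := InRLAux.exists_bound k true A M₁ i₁ h₁
    ((MonoidHom.fst M₁ M₂).comp S.subtype ∘ lift ∘ g)
  obtain ⟨N₂, hN₂⟩ := InRLAux.exists_bound k false A M₂ i₂ h₂
    ((MonoidHom.snd M₁ M₂).comp S.subtype ∘ lift ∘ g)
  refine ⟨max N₁ N₂, fun n hn u v hX hY => ?_⟩
  have e₁ := hN₁ n (le_of_max_le_left hn) u v hX
  have e₂ := hN₂ n (le_of_max_le_right hn) u v hY
  rw [← map_wordEval, ← map_wordEval] at e₁ e₂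
  have hg : g = f ∘ lift ∘ g := funext fun a => (hlift (g a)).symm
  rw [hg, ← map_wordEval, ← map_wordEval, Subtype.ext (Prod.ext e₁ e₂)]

lemma apply_ofList_eq_wordEval {A M : Type} [Monoid M] (φ : FreeMonoid A →* M) (u : List A) :
    φ (FreeMonoid.ofList u) = wordEval (fun a => φ (FreeMonoid.of a)) u := by
  induction u with
  | nil => exact map_one φ
  | cons a u ih => rw [FreeMonoid.ofList_cons, map_mul, ih, wordEval_cons]

/-- Theorem: the relations refine every homomorphism into the respective level. -/
theorem relations_imply_equality_under_hom (A : Type) [Fintype A] (M : Type) [Monoid M]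
    [Finite M] (φ : FreeMonoid A →* M) (m : ℕ) (hm : 1 ≤ m) :
    (InRm m M → ∃ n : ℕ, 1 ≤ n ∧ ∀ u v : List A,
      wEquiv ZKind.X m n (GWord.ofList u) (GWord.ofList v) →
        φ (FreeMonoid.ofList u) = φ (FreeMonoid.ofList v)) ∧
    (InLm m M → ∃ n : ℕ, 1 ≤ n ∧ ∀ u v : List A,
      wEquiv ZKind.Y m n (GWord.ofList u) (GWord.ofList v) →
        φ (FreeMonoid.ofList u) = φ (FreeMonoid.ofList v)) ∧
    (InJoin m M → ∃ n : ℕ, 1 ≤ n ∧ ∀ u v : List A,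
      wEquiv ZKind.XY m n (GWord.ofList u) (GWord.ofList v) →
        φ (FreeMonoid.ofList u) = φ (FreeMonoid.ofList v)) ∧
    (InRm (m + 1) M ∧ InLm (m + 1) M → ∃ n : ℕ, 1 ≤ n ∧ ∀ u v : List A,
      wEquiv ZKind.WI m n (GWord.ofList u) (GWord.ofList v) →
        φ (FreeMonoid.ofList u) = φ (FreeMonoid.ofList v)) := by
  obtain ⟨k, rfl⟩ : ∃ k, m = k + 1 := ⟨m - 1, by omega⟩
  simp only [apply_ofList_eq_wordEval]
  refine ⟨fun h => ?_, fun h => ?_, fun h => ?_, fun h => ?_⟩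
  · obtain ⟨N, hN⟩ := InRLAux.exists_bound k true A M _ h fun a => φ (FreeMonoid.of a)
    exact ⟨max N 1, le_max_right _ _, fun u v huv =>
      hN _ (le_max_left _ _) u v (.of_ofList huv)⟩
  · obtain ⟨N, hN⟩ := InRLAux.exists_bound k false A M _ h fun a => φ (FreeMonoid.of a)
    exact ⟨max N 1, le_max_right _ _, fun u v huv =>
      hN _ (le_max_left _ _) u v (.of_ofList huv)⟩
  · obtain ⟨N, hN⟩ := h.exists_bound fun a => φ (FreeMonoid.of a)
    exact ⟨max N 1, le_max_right _ _, fun u v huv =>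
      hN _ (le_max_left _ _) u v (.of_ofList huv.1) (.of_ofList huv.2)⟩
  · obtain ⟨N, hN⟩ := InRLAux.exists_bound_WI k A M _ h.1 h.2 fun a => φ (FreeMonoid.of a)
    exact ⟨max N 1, le_max_right _ _, fun u v huv =>
      hN _ (le_max_left _ _) u v (.of_ofList huv)⟩
end
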